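/- For every γ ∈ (0,1) there exists a constant d₀ such that the following holds for all d ≥ d₀ and all real k with 1 ≤ k ≤ d^{2γ}. Suppose G = (V,E) is a graph and L : V → 2^ℕ is a list assignment for G such that: (S1) for every vertex v ∈ V and color c ∈ L(v), deg_L(v,c) ≤ d; (S2) for every vertex v ∈ V and color c ∈ L(v), the induced subgraph G[N_L(v,c)] contains at most k edges; (S3) for every v ∈ V, |L(v)| ≥ 4(1+γ)d / log(d/√k). Then G admits a proper L-coloring. -/

import Mathlib

open Finset

attribute [local instance] Classical.propDecidable

noncomputable section


/-- The number of ordered pairs of adjacent vertices inside `S`; this is exactly twice the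
number of edges of the subgraph of `G` induced on `S`. -/
def pairsWithin {V : Type} [Fintype V] (G : SimpleGraph V) (S : Finset V) : ℕ :=
  ((S ×ˢ S).filter fun p => G.Adj p.1 p.2).card

/-- `N_L(v, c)`: the neighbors of `v` whose list contains the color `c`. -/
def NL {V : Type} [Fintype V] (G : SimpleGraph V) (L : V → Finset ℕ) (v : V) (c : ℕ) :
    Finset V :=
  (G.neighborFinset v).filter fun u => c ∈ L u


set_option linter.unusedSectionVars false

namespace LC

section Prob
variable {ι : Type} [Fintype ι]

def wt (g : ι → ℝ) (ω : ι → Bool) : ℝ := ∏ i, (if ω i = true then g i else 1 - g i)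

def Ex (g : ι → ℝ) (f : (ι → Bool) → ℝ) : ℝ := ∑ ω, wt g ω * f ω

def ind (P : Prop) : ℝ := if P then 1 else 0

lemma ind_pos {P : Prop} (h : P) : ind P = 1 := if_pos h

lemma ind_neg {P : Prop} (h : ¬ P) : ind P = 0 := if_neg h

lemma ind_nonneg (P : Prop) : 0 ≤ ind P := by unfold ind; split_ifs <;> norm_num

lemma ind_le_one (P : Prop) : ind P ≤ 1 := by unfold ind; split_ifs <;> norm_num

def Pr (g : ι → ℝ) (A : (ι → Bool) → Prop) : ℝ := Ex g (fun ω => ind (A ω))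

def Dep {α : Type} (S : Set ι) (f : (ι → Bool) → α) : Prop :=
  ∀ ω ω' : ι → Bool, (∀ i ∈ S, ω i = ω' i) → f ω = f ω'

def pw (S : Set ι) (τ η : ι → Bool) : ι → Bool := fun i => if i ∈ S then τ i else η i

def Valid (g : ι → ℝ) : Prop := ∀ i, 0 ≤ g i ∧ g i ≤ 1

lemma wt_nonneg {g : ι → ℝ} (hg : Valid g) (ω : ι → Bool) : 0 ≤ wt g ω := by
  unfold wt
  apply Finset.prod_nonneg
  intro i _
  split_ifs
  · exact (hg i).1
  · linarith [(hg i).2]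

lemma Ex_prod_coord (g : ι → ℝ) (F : ι → Bool → ℝ) :
    Ex g (fun ω => ∏ i, F i (ω i)) = ∏ i, (g i * F i true + (1 - g i) * F i false) := by
  unfold Ex wt
  have h := Finset.prod_univ_sum (fun _ : ι => (Finset.univ : Finset Bool))
    (fun i b => (if b = true then g i else 1 - g i) * F i b)
  simp only [Fintype.piFinset_univ] at h
  calc _ = ∑ ω : ι → Bool, ∏ i, ((if ω i = true then g i else 1 - g i) * F i (ω i)) := by
        apply Finset.sum_congr rfl
        intro ω _
        rw [Finset.prod_mul_distrib]
    _ = _ := by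
        rw [← h]
        apply Finset.prod_congr rfl
        intro i _
        simp

lemma Ex_one (g : ι → ℝ) : Ex g (fun _ => 1) = 1 := by
  have := Ex_prod_coord g (fun _ _ => 1)
  simpa using this

lemma Ex_const (g : ι → ℝ) (a : ℝ) : Ex g (fun _ => a) = a := by
  have := Ex_one g
  unfold Ex at *
  simp only [mul_one] at this
  rw [← Finset.sum_mul, this, one_mul]

lemma sum_wt (g : ι → ℝ) : ∑ ω, wt g ω = 1 := by
  have := Ex_one g
  simpa [Ex] using this

lemma Ex_mono {g : ι → ℝ} (hg : Valid g) {f h : (ι → Bool) → ℝ} (H : ∀ ω, f ω ≤ h ω) :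
    Ex g f ≤ Ex g h := by
  unfold Ex
  exact Finset.sum_le_sum fun ω _ => mul_le_mul_of_nonneg_left (H ω) (wt_nonneg hg ω)

lemma Ex_add (g : ι → ℝ) (f h : (ι → Bool) → ℝ) :
    Ex g (fun ω => f ω + h ω) = Ex g f + Ex g h := by
  unfold Ex
  simp [mul_add, Finset.sum_add_distrib]

lemma Ex_sub (g : ι → ℝ) (f h : (ι → Bool) → ℝ) :
    Ex g (fun ω => f ω - h ω) = Ex g f - Ex g h := by
  unfold Ex
  simp [mul_sub, Finset.sum_sub_distrib]

lemma Ex_smul (g : ι → ℝ) (a : ℝ) (f : (ι → Bool) → ℝ) :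
    Ex g (fun ω => a * f ω) = a * Ex g f := by
  unfold Ex
  rw [Finset.mul_sum]
  exact Finset.sum_congr rfl fun ω _ => by ring

lemma Ex_sum {J : Type} (g : ι → ℝ) (s : Finset J) (f : J → (ι → Bool) → ℝ) :
    Ex g (fun ω => ∑ j ∈ s, f j ω) = ∑ j ∈ s, Ex g (f j) := by
  unfold Ex
  simp only [Finset.mul_sum]
  exact Finset.sum_comm

lemma Ex_nonneg {g : ι → ℝ} (hg : Valid g) {f : (ι → Bool) → ℝ} (H : ∀ ω, 0 ≤ f ω) :
    0 ≤ Ex g f := by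
  unfold Ex
  exact Finset.sum_nonneg fun ω _ => mul_nonneg (wt_nonneg hg ω) (H ω)

lemma Pr_nonneg {g : ι → ℝ} (hg : Valid g) (A : (ι → Bool) → Prop) : 0 ≤ Pr g A := by
  apply Ex_nonneg hg
  intro ω; exact ind_nonneg _

lemma Pr_mono {g : ι → ℝ} (hg : Valid g) {A B : (ι → Bool) → Prop} (H : ∀ ω, A ω → B ω) :
    Pr g A ≤ Pr g B := by
  apply Ex_mono hg
  intro ω
  by_cases h : A ω
  · simp [ind, h, H ω h]
  · by_cases h' : B ω <;> simp [ind, h, h']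

lemma Pr_or {g : ι → ℝ} (hg : Valid g) (A B : (ι → Bool) → Prop) :
    Pr g (fun ω => A ω ∨ B ω) ≤ Pr g A + Pr g B := by
  unfold Pr
  rw [← Ex_add]
  apply Ex_mono hg
  intro ω
  by_cases h : A ω <;> by_cases h' : B ω <;> simp [ind, h, h']

lemma Pr_exists {J : Type} {g : ι → ℝ} (hg : Valid g) (s : Finset J)
    (A : J → (ι → Bool) → Prop) :
    Pr g (fun ω => ∃ j ∈ s, A j ω) ≤ ∑ j ∈ s, Pr g (A j) := by
  unfold Pr
  rw [← Ex_sum]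
  apply Ex_mono hg
  intro ω
  have h0 : ∀ j ∈ s, 0 ≤ ind (A j ω) := by
    intro j _; exact ind_nonneg _
  by_cases h : ∃ j ∈ s, A j ω
  · obtain ⟨j, hj, hA⟩ := h
    have := Finset.single_le_sum h0 hj
    rw [ind_pos hA] at this
    rw [ind_pos ⟨j, hj, hA⟩]
    exact this
  · rw [ind_neg h]
    exact Finset.sum_nonneg h0

/-- Markov. -/
lemma Pr_le_Ex {g : ι → ℝ} (hg : Valid g) {A : (ι → Bool) → Prop} {f : (ι → Bool) → ℝ}
    (h0 : ∀ ω, 0 ≤ f ω) (h1 : ∀ ω, A ω → 1 ≤ f ω) : Pr g A ≤ Ex g f := by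
  apply Ex_mono hg
  intro ω
  by_cases h : A ω
  · simpa [ind, h] using h1 ω h
  · simpa [ind, h] using h0 ω

lemma Ex_resample (g : ι → ℝ) (S : Set ι) (f : (ι → Bool) → ℝ) :
    Ex g f = Ex g (fun η => Ex g (fun τ => f (pw S τ η))) := by
  have key : ∀ η τ : ι → Bool, wt g (pw S τ η) * wt g (pw S η τ) = wt g η * wt g τ := by
    intro η τ
    unfold wt pw
    rw [← Finset.prod_mul_distrib, ← Finset.prod_mul_distrib]
    apply Finset.prod_congr rfl
    intro i _
    by_cases h : i ∈ S
    · simp [h, mul_comm]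
    · simp [h]
  let e : ((ι → Bool) × (ι → Bool)) ≃ ((ι → Bool) × (ι → Bool)) :=
    { toFun := fun q => (pw S q.2 q.1, pw S q.1 q.2)
      invFun := fun q => (pw S q.2 q.1, pw S q.1 q.2)
      left_inv := by
        intro q
        ext i <;> by_cases h : i ∈ S <;> simp [pw, h]
      right_inv := by
        intro q
        ext i <;> by_cases h : i ∈ S <;> simp [pw, h] }
  have h1 : Ex g (fun η => Ex g (fun τ => f (pw S τ η)))
      = ∑ q : (ι → Bool) × (ι → Bool), wt g q.1 * wt g q.2 * f (e q).1 := by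
    unfold Ex
    rw [Fintype.sum_prod_type]
    apply Finset.sum_congr rfl
    intro η _
    rw [Finset.mul_sum]
    apply Finset.sum_congr rfl
    intro τ _
    simp only [e, Equiv.coe_fn_mk]
    ring
  have h2 : ∑ q : (ι → Bool) × (ι → Bool), wt g q.1 * wt g q.2 * f (e q).1
      = ∑ q : (ι → Bool) × (ι → Bool), wt g q.1 * wt g q.2 * f q.1 := by
    rw [← Equiv.sum_comp e (fun q => wt g q.1 * wt g q.2 * f q.1)]
    apply Finset.sum_congr rfl
    intro q _
    have := key q.1 q.2
    simp only [e, Equiv.coe_fn_mk]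
    rw [this]
  rw [h1, h2, Fintype.sum_prod_type]
  unfold Ex
  apply Finset.sum_congr rfl
  intro η _
  have : ∑ τ : ι → Bool, wt g η * wt g τ * f η = wt g η * f η * ∑ τ, wt g τ := by
    rw [Finset.mul_sum]
    exact Finset.sum_congr rfl fun τ _ => by ring
  simp only [this, sum_wt, mul_one]

lemma Dep.mono {α : Type} {S T : Set ι} {f : (ι → Bool) → α} (h : Dep S f) (hST : S ⊆ T) :
    Dep T f := fun ω ω' H => h ω ω' fun i hi => H i (hST hi)

lemma Ex_mul (g : ι → ℝ) {S T : Set ι} (hd : Disjoint S T) {f h : (ι → Bool) → ℝ}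
    (hf : Dep S f) (hh : Dep T h) : Ex g (fun ω => f ω * h ω) = Ex g f * Ex g h := by
  rw [Ex_resample g S]
  have : ∀ η τ : ι → Bool, f (pw S τ η) * h (pw S τ η) = h η * f τ := by
    intro η τ
    have h1 : f (pw S τ η) = f τ := hf _ _ fun i hi => by simp [pw, hi]
    have h2 : h (pw S τ η) = h η := hh _ _ fun i hi => by
      have : i ∉ S := fun hi' => (Set.disjoint_left.mp hd hi' hi)
      simp [pw, this]
    rw [h1, h2, mul_comm]
  simp only [this]
  simp only [Ex_smul]
  have e : (fun η => h η * Ex g f) = (fun η => Ex g f * h η) := by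
    funext η; ring
  rw [e, Ex_smul]

lemma Dep.ite {S : Set ι} {A : (ι → Bool) → Prop} (h : Dep S A) :
    Dep S (fun ω => ind (A ω)) := by
  intro ω ω' H
  have := h ω ω' H
  simp only [this]

lemma Pr_and (g : ι → ℝ) {S T : Set ι} (hd : Disjoint S T) {A B : (ι → Bool) → Prop}
    (hf : Dep S A) (hh : Dep T B) : Pr g (fun ω => A ω ∧ B ω) = Pr g A * Pr g B := by
  unfold Pr
  rw [← Ex_mul g hd hf.ite hh.ite]
  congr 1
  funext ω
  by_cases h : A ω <;> by_cases h' : B ω <;> simp [ind, h, h']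

/-- product over colour classes -/
lemma Ex_prod {C : Type} (g : ι → ℝ) (κ : ι → C) (R : Finset C) (f : C → (ι → Bool) → ℝ)
    (hf : ∀ c ∈ R, Dep {i | κ i = c} (f c)) :
    Ex g (fun ω => ∏ c ∈ R, f c ω) = ∏ c ∈ R, Ex g (f c) := by
  induction R using Finset.induction_on with
  | empty => simpa using Ex_one g
  | insert a s ha ih =>
    simp only [Finset.prod_insert ha]
    rw [Ex_mul g (S := {i | κ i = a}) (T := {i | κ i ∈ s}), ih]
    · intro c hc; exact hf c (Finset.mem_insert_of_mem hc)
    · rw [Set.disjoint_left]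
      intro i hi hi'
      simp only [Set.mem_ofPred_eq] at hi hi'
      exact ha (hi ▸ hi')
    · exact hf a (Finset.mem_insert_self _ _)
    · intro ω ω' H
      apply Finset.prod_congr rfl
      intro c hc
      apply hf c (Finset.mem_insert_of_mem hc)
      intro i hi
      apply H
      simp only [Set.mem_ofPred_eq] at hi ⊢
      rw [hi]; exact hc

lemma Pr_all_true (g : ι → ℝ) (Q : Finset ι) :
    Pr g (fun ω => ∀ i ∈ Q, ω i = true) = ∏ i ∈ Q, g i := by
  unfold Pr
  have h := Ex_prod_coord g (fun i b => if i ∈ Q then (if b = true then 1 else 0) else 1)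
  have e : (fun ω : ι → Bool => ind (∀ i ∈ Q, ω i = true))
      = fun ω => ∏ i, (if i ∈ Q then (if ω i = true then (1:ℝ) else 0) else 1) := by
    funext ω
    by_cases hQ : ∀ i ∈ Q, ω i = true
    · rw [ind_pos hQ, Finset.prod_eq_one]
      intro i _
      by_cases hi : i ∈ Q
      · simp [hi, hQ i hi]
      · simp [hi]
    · rw [ind_neg hQ]
      push Not at hQ
      obtain ⟨i, hi, hω⟩ := hQ
      symm
      apply Finset.prod_eq_zero (Finset.mem_univ i)
      simp [hi, hω]
  rw [e, h, ← Finset.prod_subset (Finset.subset_univ Q)]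
  · apply Finset.prod_congr rfl
    intro i hi
    simp [hi]
  · intro i _ hi
    simp [hi]

/-- Lower-tail Chernoff. -/
lemma chernoff {C : Type} {g : ι → ℝ} (hg : Valid g) (κ : ι → C) (R : Finset C)
    (f : C → (ι → Bool) → ℝ)
    (hf : ∀ c ∈ R, Dep {i | κ i = c} (f c)) (h01 : ∀ c ∈ R, ∀ ω, 0 ≤ f c ω ∧ f c ω ≤ 1)
    (μ δ : ℝ) (hδ0 : 0 ≤ δ) (hδ1 : δ ≤ 1) (hμ : μ ≤ ∑ c ∈ R, Ex g (f c)) :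
    Pr g (fun ω => ∑ c ∈ R, f c ω < (1 - δ) * μ) ≤ Real.exp (-(δ ^ 2 * μ / 2)) := by
  have h1 : Pr g (fun ω => ∑ c ∈ R, f c ω < (1 - δ) * μ) ≤
      Ex g (fun ω => Real.exp (δ * (1 - δ) * μ) * ∏ c ∈ R, Real.exp (-(δ * f c ω))) := by
    apply Pr_le_Ex hg
    · intro ω
      positivity
    · intro ω hω
      rw [← Real.exp_sum, ← Real.exp_add, Real.one_le_exp_iff]
      rw [Finset.sum_neg_distrib, ← Finset.mul_sum]
      nlinarith
  refine h1.trans ?_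
  rw [Ex_smul, Ex_prod g κ R]
  swap
  · intro c hc ω ω' H
    simp only [hf c hc ω ω' H]
  set t := δ - δ ^ 2 / 2 with ht
  have hexp : ∀ x : ℝ, 0 ≤ x → x ≤ 1 → Real.exp (-(δ * x)) ≤ 1 - t * x := by
    intro x hx0 hx1
    have hc : Real.exp (-(δ * x)) ≤ 1 + x * (Real.exp (-δ) - 1) := by
      have := convexOn_exp.2 (Set.mem_univ (-δ)) (Set.mem_univ 0) hx0 (by linarith : 0 ≤ 1 - x)
        (by ring)
      simp only [smul_eq_mul, mul_zero, add_zero, Real.exp_zero, mul_one] at this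
      calc _ = Real.exp (x * -δ) := by ring_nf
        _ ≤ _ := this
        _ = _ := by ring
    have hd : Real.exp (-δ) ≤ 1 - t := by
      have := Real.quadratic_le_exp_of_nonneg hδ0
      have hp : (0:ℝ) < 1 + δ + δ ^ 2 / 2 := by positivity
      rw [Real.exp_neg]
      calc (Real.exp δ)⁻¹ ≤ (1 + δ + δ ^ 2 / 2)⁻¹ := by gcongr
        _ ≤ 1 - t := by
          rw [inv_le_iff_one_le_mul₀ hp]
          rw [ht]
          nlinarith [sq_nonneg (δ^2)]
    nlinarith
  have hfac : ∀ c ∈ R, Ex g (fun ω => Real.exp (-(δ * f c ω))) ≤ Real.exp (-(t * Ex g (f c))) := by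
    intro c hc
    calc _ ≤ Ex g (fun ω => 1 - t * f c ω) :=
          Ex_mono hg fun ω => hexp _ (h01 c hc ω).1 (h01 c hc ω).2
      _ = 1 - t * Ex g (f c) := by rw [Ex_sub, Ex_const, Ex_smul]
      _ ≤ _ := by
        have := Real.add_one_le_exp (-(t * Ex g (f c)))
        linarith
  calc _ ≤ Real.exp (δ * (1 - δ) * μ) * ∏ c ∈ R, Real.exp (-(t * Ex g (f c))) := by
        gcongr with c hc
        · intro c hc
          exact Ex_nonneg hg fun ω => (Real.exp_pos _).le
        · exact hfac c hc
    _ ≤ _ := by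
        rw [← Real.exp_sum, ← Real.exp_add, Real.exp_le_exp, Finset.sum_neg_distrib,
          ← Finset.mul_sum]
        have ht0 : 0 ≤ t := by rw [ht]; nlinarith
        have := mul_le_mul_of_nonneg_left hμ ht0
        rw [ht] at this ⊢
        nlinarith

/-- symmetric Lovász local lemma -/
lemma lll {J : Type} [Fintype J] {g : ι → ℝ} (hg : Valid g) (B : J → (ι → Bool) → Prop)
    (S : J → Set ι) (hdep : ∀ j, Dep (S j) (B j)) (x D : ℝ)
    (hx : ∀ j, Pr g (B j) ≤ x)
    (hD : ∀ j, ((univ.filter fun j' => ¬ Disjoint (S j) (S j')).card : ℝ) ≤ D)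
    (hx0 : 0 ≤ x) (hxD : 4 * x * D ≤ 1) (hx1 : x ≤ 1 / 4) :
    ∃ ω, ∀ j, ¬ B j ω := by
  have main : ∀ n : ℕ, ∀ T : Finset J, T.card = n → 
      0 < Pr g (fun ω => ∀ j ∈ T, ¬ B j ω) ∧ ∀ i, 
      Pr g (fun ω => B i ω ∧ ∀ j ∈ T, ¬ B j ω) ≤ 2 * x * Pr g (fun ω => ∀ j ∈ T, ¬ B j ω) := by
    intro n
    induction n using Nat.strong_induction_on with
    | _ n ih =>
    intro T hT
    have pos : 0 < Pr g (fun ω => ∀ j ∈ T, ¬ B j ω) := by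
      rcases T.eq_empty_or_nonempty with h | ⟨a, ha⟩
      · subst h
        have : (fun ω : ι → Bool => ind (∀ j ∈ (∅ : Finset J), ¬ B j ω))
            = fun _ => 1 := by funext ω; simp [ind]
        unfold Pr
        rw [this, Ex_one]; norm_num
      · obtain ⟨p1, p2⟩ := ih (T.erase a).card (by rw [← hT]; exact Finset.card_erase_lt_of_mem ha)
          (T.erase a) rfl
        have := p2 a
        have le : Pr g (fun ω => ∀ j ∈ T.erase a, ¬ B j ω) ≤
            Pr g (fun ω => ∀ j ∈ T, ¬ B j ω) +
            Pr g (fun ω => B a ω ∧ ∀ j ∈ T.erase a, ¬ B j ω) := by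
          refine le_trans (Pr_mono hg ?_) (Pr_or hg _ _)
          intro ω hω
          by_cases hB : B a ω
          · exact Or.inr ⟨hB, hω⟩
          · left
            intro j hj
            by_cases hja : j = a
            · rwa [hja]
            · exact hω j (Finset.mem_erase.mpr ⟨hja, hj⟩)
        nlinarith
    refine ⟨pos, fun i => ?_⟩
    set T1 := T.filter fun j => ¬ Disjoint (S i) (S j) with hT1
    set T2 := T.filter fun j => Disjoint (S i) (S j) with hT2
    set P2 := Pr g (fun ω => ∀ j ∈ T2, ¬ B j ω) with hP2
    have a1 : Pr g (fun ω => B i ω ∧ ∀ j ∈ T, ¬ B j ω) ≤ x * P2 := by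
      calc _ ≤ Pr g (fun ω => B i ω ∧ ∀ j ∈ T2, ¬ B j ω) := by
            apply Pr_mono hg
            rintro ω ⟨h1, h2⟩
            exact ⟨h1, fun j hj => h2 j (Finset.mem_filter.mp hj).1⟩
        _ = Pr g (B i) * P2 := by
            apply Pr_and g (S := S i) (T := ⋃ j ∈ T2, S j)
            · rw [Set.disjoint_iUnion₂_right]
              intro j hj
              exact (Finset.mem_filter.mp hj).2
            · exact hdep i
            · intro ω ω' H
              apply propext
              apply forall₂_congr
              intro j hj
              rw [hdep j ω ω' fun i hi => H i (Set.mem_biUnion hj hi)]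
        _ ≤ _ := mul_le_mul_of_nonneg_right (hx i) (Pr_nonneg hg _)
    by_cases hne : T1 = ∅
    · have : T2 = T := by
        ext j
        constructor
        · intro h; exact (Finset.mem_filter.mp h).1
        · intro h
          rw [hT2, Finset.mem_filter]
          refine ⟨h, ?_⟩
          by_contra hc
          have : j ∈ T1 := by rw [hT1, Finset.mem_filter]; exact ⟨h, hc⟩
          rw [hne] at this; simp at this
      rw [hP2, this] at a1
      nlinarith
    · obtain ⟨a, ha⟩ := Finset.nonempty_iff_ne_empty.mpr hne
      have hlt : T2.card < n := by
        rw [← hT]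
        apply Finset.card_lt_card
        refine ⟨Finset.filter_subset _ _, fun hc => ?_⟩
        have h1 := (Finset.mem_filter.mp (hc (Finset.mem_filter.mp ha).1)).2
        exact (Finset.mem_filter.mp ha).2 h1
      obtain ⟨q1, q2⟩ := ih _ hlt T2 rfl
      have le : P2 ≤ Pr g (fun ω => ∀ j ∈ T, ¬ B j ω) +
          Pr g (fun ω => ∃ j ∈ T1, B j ω ∧ ∀ j ∈ T2, ¬ B j ω) := by
        refine le_trans (Pr_mono hg ?_) (Pr_or hg _ _)
        intro ω hω
        by_cases hB : ∃ j ∈ T1, B j ω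
        · obtain ⟨j, hj, hj'⟩ := hB
          exact Or.inr ⟨j, hj, hj', hω⟩
        · left
          intro j hj hjB
          by_cases hd : Disjoint (S i) (S j)
          · exact hω j (Finset.mem_filter.mpr ⟨hj, hd⟩) hjB
          · exact hB ⟨j, Finset.mem_filter.mpr ⟨hj, hd⟩, hjB⟩
      have le2 : Pr g (fun ω => ∃ j ∈ T1, B j ω ∧ ∀ j ∈ T2, ¬ B j ω) ≤ D * (2 * x * P2) := by
        refine (Pr_exists hg T1 _).trans ?_
        calc _ ≤ ∑ j ∈ T1, (2 * x * P2) := Finset.sum_le_sum fun j _ => q2 j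
          _ = T1.card * (2 * x * P2) := by rw [Finset.sum_const, nsmul_eq_mul]
          _ ≤ _ := by
            apply mul_le_mul_of_nonneg_right _ (by positivity)
            refine le_trans ?_ (hD i)
            exact_mod_cast Finset.card_le_card (Finset.filter_subset_filter _ (Finset.subset_univ _))
      have : P2 ≤ 2 * Pr g (fun ω => ∀ j ∈ T, ¬ B j ω) := by nlinarith
      nlinarith
  obtain ⟨hpos, -⟩ := main _ univ rfl
  by_contra hcon
  push Not at hcon
  have : Pr g (fun ω => ∀ j ∈ (univ : Finset J), ¬ B j ω) = 0 := by
    unfold Pr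
    have : (fun ω : ι → Bool => ind (∀ j ∈ (univ : Finset J), ¬ B j ω))
        = fun _ => 0 := by
      funext ω
      obtain ⟨j, hj⟩ := hcon ω
      rw [ind_neg]
      intro h
      exact h j (Finset.mem_univ j) hj
    rw [this, Ex_const]
  linarith

end Prob
end LC

set_option linter.unusedSectionVars false

namespace LC

section Graph
variable {V C : Type} [Fintype V] [Fintype C] (G : SimpleGraph V) (L : V → Finset C)

def N (v : V) (c : C) : Finset V := univ.filter fun u => G.Adj v u ∧ c ∈ L u

def kset (v : V) (c : C) : Finset (V × C × Bool) :=
  insert (v, c, true) ((N G L v c).image fun u => (u, c, false))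

def kept (ω : V × C × Bool → Bool) (v : V) (c : C) : Prop := ∀ i ∈ kset G L v c, ω i = true

def colby (ω : V × C × Bool → Bool) (u : V) (c : C) : Prop :=
  c ∈ L u ∧ ω (u, c, false) = false ∧ kept G L ω u c

def gp (p : ℝ) (n : ℕ) : V × C × Bool → ℝ :=
  fun i => if i.2.2 = true then (1 - p) ^ (n - (N G L i.1 i.2.1).card) else 1 - p

variable {G L}

lemma mem_N {v u : V} {c : C} : u ∈ N G L v c ↔ G.Adj v u ∧ c ∈ L u := by
  simp [N]

lemma gp_valid {p : ℝ} (n : ℕ) (hp0 : 0 ≤ p) (hp1 : p ≤ 1) : Valid (gp G L p n) := by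
  intro i
  unfold gp
  split_ifs
  · exact ⟨pow_nonneg (by linarith) _, pow_le_one₀ (by linarith) (by linarith)⟩
  · constructor <;> linarith

lemma prod_image_false (p : ℝ) (n : ℕ) (c : C) (S : Finset V) :
    ∏ i ∈ S.image (fun u => ((u, c, false) : V × C × Bool)), gp G L p n i = (1 - p) ^ S.card := by
  rw [Finset.prod_image (by intro a _ b _ h; simpa using h)]
  simp [gp]

lemma prod_kset (p : ℝ) (n : ℕ) (v : V) (c : C) (h : (N G L v c).card ≤ n) :
    ∏ i ∈ kset G L v c, gp G L p n i = (1 - p) ^ n := by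
  unfold kset
  rw [Finset.prod_insert (by simp), prod_image_false]
  simp only [gp, if_true]
  rw [← pow_add]
  congr 1
  omega

lemma Pr_kept (p : ℝ) (n : ℕ) (v : V) (c : C) (h : (N G L v c).card ≤ n) :
    Pr (gp G L p n) (fun ω => kept G L ω v c) = (1 - p) ^ n := by
  unfold kept
  rw [Pr_all_true, prod_kset p n v c h]

lemma Pr_kept2 (p : ℝ) (n : ℕ) (v u : V) (c : C) (h : (N G L v c).card ≤ n)
    (h' : (N G L u c).card ≤ n) (huv : v ≠ u) :
    Pr (gp G L p n) (fun ω => kept G L ω v c ∧ kept G L ω u c)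
      * (1 - p) ^ (N G L v c ∩ N G L u c).card = (1 - p) ^ n * (1 - p) ^ n := by
  have e : (fun ω => kept G L ω v c ∧ kept G L ω u c) =
      fun ω => ∀ i ∈ kset G L v c ∪ kset G L u c, ω i = true := by
    funext ω
    apply propext
    unfold kept
    constructor
    · rintro ⟨h1, h2⟩ i hi
      rcases Finset.mem_union.mp hi with hi | hi
      · exact h1 i hi
      · exact h2 i hi
    · intro H
      exact ⟨fun i hi => H i (Finset.mem_union_left _ hi), fun i hi => H i (Finset.mem_union_right _ hi)⟩
  have e2 : kset G L v c ∩ kset G L u c =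
      (N G L v c ∩ N G L u c).image fun w => ((w, c, false) : V × C × Bool) := by
    ext ⟨w, c', b⟩
    simp only [kset, Finset.mem_inter, Finset.mem_insert, Finset.mem_image, Prod.mk.injEq]
    constructor
    · rintro ⟨h1 | ⟨a, ha, h1⟩, h2 | ⟨b', hb, h2⟩⟩
      · exact absurd (h1.1.symm.trans h2.1) huv
      · have := h1.2.2.symm.trans h2.2.2.symm; simp at this
      · have := h2.2.2.symm.trans h1.2.2.symm; simp at this
      · refine ⟨a, ⟨ha, ?_⟩, h1⟩
        rw [h1.1, ← h2.1]; exact hb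
    · rintro ⟨a, ⟨h1, h2⟩, h3⟩
      exact ⟨Or.inr ⟨a, h1, h3⟩, Or.inr ⟨a, h2, h3⟩⟩
  rw [e, Pr_all_true, ← prod_image_false (G := G) (L := L) p n c, ← e2,
    Finset.prod_union_inter, prod_kset p n v c h, prod_kset p n u c h']

lemma kept_congr {ω ω' : V × C × Bool → Bool} {v : V} {c : C}
    (h : ∀ i ∈ kset G L v c, ω i = ω' i) : kept G L ω v c = kept G L ω' v c := by
  unfold kept
  apply propext
  apply forall₂_congr
  intro i hi
  rw [h i hi]

lemma kset_color {v : V} {c : C} {i : V × C × Bool} (hi : i ∈ kset G L v c) : i.2.1 = c := by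
  simp only [kset, Finset.mem_insert, Finset.mem_image] at hi
  rcases hi with h | ⟨a, _, h⟩
  · rw [h]
  · rw [← h]

lemma dep_kept (v : V) (c : C) :
    Dep {i : V × C × Bool | i.2.1 = c} (fun ω => kept G L ω v c) := by
  intro ω ω' H
  apply kept_congr
  intro i hi
  exact H i (kset_color hi)

variable (G L)

def Zs (ω : V × C × Bool → Bool) (u : V) (c : C) : Finset C :=
  ((L u).erase c).filter fun c' => kept G L ω u c'

def unc (ω : V × C × Bool → Bool) (u : V) (c : C) : Prop :=
  ∀ c' ∈ Zs G L ω u c, ω (u, c', false) = true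

variable {G L}

lemma core {p : ℝ} (n : ℕ) (hp0 : 0 ≤ p) (hp1 : p ≤ 1) (c : C) (z : ℕ) (T : Finset V)
    (hT : ∀ u ∈ T, ∀ w ∈ T, ¬ G.Adj u w) :
    Pr (gp G L p n) (fun ω => ∀ u ∈ T, unc G L ω u c ∧ z ≤ (Zs G L ω u c).card)
      ≤ ((1 - p) ^ z) ^ T.card := by
  have hv := gp_valid (G := G) (L := L) n hp0 hp1
  set S : Set (V × C × Bool) := {i | i.1 ∈ T ∧ i.2.2 = false} with hS
  unfold Pr
  rw [Ex_resample _ S]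
  rw [← Ex_const (gp G L p n) (((1 - p) ^ z) ^ T.card)]
  apply Ex_mono hv
  intro η
  have hk : ∀ τ, ∀ u ∈ T, ∀ c', kept G L (pw S τ η) u c' = kept G L η u c' := by
    intro τ u hu c'
    apply kept_congr
    intro i hi
    have : i ∉ S := by
      intro hiS
      simp only [kset, Finset.mem_insert, Finset.mem_image] at hi
      rcases hi with h | ⟨a, ha, h⟩
      · rw [h] at hiS
        have := hiS.2
        simp at this
      · rw [← h] at hiS
        exact hT u hu a hiS.1 (mem_N.mp ha).1
    simp [pw, this]
  have hZ : ∀ τ, ∀ u ∈ T, Zs G L (pw S τ η) u c = Zs G L η u c := by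
    intro τ u hu
    unfold Zs
    apply Finset.filter_congr
    intro c' _
    rw [hk τ u hu c']
  by_cases hz : ∀ u ∈ T, z ≤ (Zs G L η u c).card
  · set Q : Finset (V × C × Bool) :=
      (T.sigma fun u => Zs G L η u c).image (fun q => (q.1, q.2, false)) with hQ
    have hQc : Q.card = ∑ u ∈ T, (Zs G L η u c).card := by
      rw [hQ, Finset.card_image_of_injective, Finset.card_sigma]
      rintro ⟨a, b⟩ ⟨a', b'⟩ h
      simp only [Prod.mk.injEq, and_true] at h
      obtain ⟨h1, h2⟩ := h
      subst h1; subst h2; rfl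
    calc _ ≤ Pr (gp G L p n) (fun τ => ∀ i ∈ Q, τ i = true) := by
          apply Pr_mono hv
          intro τ hτ i hi
          rw [hQ, Finset.mem_image] at hi
          obtain ⟨q, hq, rfl⟩ := hi
          rw [Finset.mem_sigma] at hq
          have := (hτ q.1 hq.1).1 q.2 (by rw [hZ τ q.1 hq.1]; exact hq.2)
          have hmem : ((q.1, q.2, false) : V × C × Bool) ∈ S := ⟨hq.1, rfl⟩
          simpa [pw, hmem] using this
      _ = (1 - p) ^ Q.card := by
          rw [Pr_all_true, Finset.prod_congr rfl (g := fun _ => 1 - p), Finset.prod_const]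
          intro i hi
          rw [hQ, Finset.mem_image] at hi
          obtain ⟨q, hq, rfl⟩ := hi
          simp [gp]
      _ ≤ (1 - p) ^ (z * T.card) := by
          apply pow_le_pow_of_le_one (by linarith) (by linarith)
          rw [hQc, mul_comm]
          have := Finset.card_nsmul_le_sum T (fun u => (Zs G L η u c).card) z hz
          simpa using this
      _ = _ := by rw [pow_mul]
  · push Not at hz
    obtain ⟨u, hu, hlt⟩ := hz
    have : (fun τ => ind (∀ u ∈ T, unc G L (pw S τ η) u c ∧ z ≤ (Zs G L (pw S τ η) u c).card))
        = fun _ => 0 := by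
      funext τ
      apply ind_neg
      intro H
      have := (H u hu).2
      rw [hZ τ u hu] at this
      omega
    rw [this, Ex_const]
    exact pow_nonneg (pow_nonneg (by linarith) _) _

lemma expmom {p : ℝ} (n : ℕ) (hp0 : 0 ≤ p) (hp1 : p ≤ 1) (c : C) (z : ℕ) (B : Finset V)
    (hB : ∀ u ∈ B, ∀ w ∈ B, ¬ G.Adj u w) (t : ℝ) (ht : 0 ≤ t) :
    Ex (gp G L p n) (fun ω => ∏ u ∈ B,
      (1 + t * ind (unc G L ω u c ∧ z ≤ (Zs G L ω u c).card)))
      ≤ (1 + t * (1 - p) ^ z) ^ B.card := by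
  have hv := gp_valid (G := G) (L := L) n hp0 hp1
  simp only [Finset.prod_one_add]
  rw [Ex_sum]
  have : (1 + t * (1 - p) ^ z) ^ B.card = ∑ T ∈ B.powerset, (t * (1 - p) ^ z) ^ T.card := by
    rw [← Finset.prod_const, Finset.prod_one_add]
    simp
  rw [this]
  apply Finset.sum_le_sum
  intro T hT
  rw [Finset.mem_powerset] at hT
  simp only [Finset.prod_mul_distrib, Finset.prod_const]
  rw [Ex_smul, mul_pow]
  apply mul_le_mul_of_nonneg_left _ (pow_nonneg ht _)
  refine le_trans (le_of_eq ?_) (core (G := G) (L := L) n hp0 hp1 c z T (fun u hu w hw => hB u (hT hu) w (hT hw)))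
  unfold Pr
  congr 1
  funext ω
  by_cases h : ∀ u ∈ T, unc G L ω u c ∧ z ≤ (Zs G L ω u c).card
  · rw [ind_pos h, Finset.prod_eq_one]
    intro u hu
    exact ind_pos (h u hu)
  · rw [ind_neg h]
    push Not at h
    obtain ⟨u, hu, hn⟩ := h
    apply Finset.prod_eq_zero hu
    apply ind_neg
    rintro ⟨h1, h2⟩
    have := hn h1
    omega

lemma classtail {p : ℝ} (n : ℕ) (hp0 : 0 ≤ p) (hp1 : p ≤ 1) (c : C) (z : ℕ) (B : Finset V)
    (hB : ∀ u ∈ B, ∀ w ∈ B, ¬ G.Adj u w) (l σ : ℝ) (hl0 : 0 ≤ l) (hl1 : l ≤ 1) :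
    Pr (gp G L p n) (fun ω => (1 - p) ^ z * B.card + 2 * l * B.card + σ <
      ∑ u ∈ B, ind (unc G L ω u c ∧ z ≤ (Zs G L ω u c).card)) ≤ Real.exp (-(l * σ)) := by
  have hv := gp_valid (G := G) (L := L) n hp0 hp1
  set U := (1 - p) ^ z with hU
  have hU0 : 0 ≤ U := pow_nonneg (by linarith) _
  have hU1 : U ≤ 1 := pow_le_one₀ (by linarith) (by linarith)
  set b : ℝ := (B.card : ℝ) with hb
  have hb0 : 0 ≤ b := by positivity
  set t := Real.exp l - 1 with ht
  have ht0 : 0 ≤ t := by rw [ht]; linarith [Real.add_one_le_exp l]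
  have ht1 : t ≤ l + l ^ 2 := by
    have := Real.abs_exp_sub_one_sub_id_le (x := l) (by rw [abs_of_nonneg hl0]; exact hl1)
    have := le_abs_self (Real.exp l - 1 - l)
    rw [ht]; linarith
  calc _ ≤ Ex (gp G L p n) (fun ω => Real.exp (-(l * (U * b + 2 * l * b + σ))) * ∏ u ∈ B,
      (1 + t * ind (unc G L ω u c ∧ z ≤ (Zs G L ω u c).card))) := by
        have key : ∀ ω, ∏ u ∈ B, (1 + t * ind (unc G L ω u c ∧ z ≤ (Zs G L ω u c).card))
            = Real.exp (l * ∑ u ∈ B, ind (unc G L ω u c ∧ z ≤ (Zs G L ω u c).card)) := by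
          intro ω
          rw [Finset.mul_sum, Real.exp_sum]
          apply Finset.prod_congr rfl
          intro u _
          by_cases h : unc G L ω u c ∧ z ≤ (Zs G L ω u c).card
          · rw [ind_pos h, ht]; simp
          · rw [ind_neg h]; simp
        apply Pr_le_Ex hv
        · intro ω
          rw [key]; positivity
        · intro ω hω
          rw [key, ← Real.exp_add, Real.one_le_exp_iff]
          nlinarith
    _ ≤ Real.exp (-(l * (U * b + 2 * l * b + σ))) * (1 + t * U) ^ B.card := by
        rw [Ex_smul]
        gcongr
        exact expmom n hp0 hp1 c z B hB t ht0
    _ ≤ Real.exp (-(l * (U * b + 2 * l * b + σ))) * (Real.exp (t * U)) ^ B.card := by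
        gcongr
        linarith [Real.add_one_le_exp (t * U)]
    _ ≤ _ := by
        rw [← Real.exp_nat_mul, ← Real.exp_add, Real.exp_le_exp]
        have : b * (t * U) ≤ b * (l * U + l ^ 2) := by
          apply mul_le_mul_of_nonneg_left _ hb0
          nlinarith
        have : 0 ≤ l ^ 2 * b := by positivity
        nlinarith

lemma greedy (n : ℕ) (S : Finset V) :
    (∀ u ∈ S, (S.filter fun w => G.Adj u w).card < n) →
    ∃ χ : V → ℕ, (∀ u ∈ S, χ u < n) ∧ ∀ u ∈ S, ∀ w ∈ S, G.Adj u w → χ u ≠ χ w := by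
  induction S using Finset.induction_on with
  | empty => intro _; exact ⟨fun _ => 0, by simp, by simp⟩
  | insert a s ha ih =>
    intro h
    obtain ⟨χ, h1, h2⟩ := ih (fun u hu => lt_of_le_of_lt
      (Finset.card_le_card (Finset.filter_subset_filter _ (Finset.subset_insert _ _)))
      (h u (Finset.mem_insert_of_mem hu)))
    have : ∃ x ∈ Finset.range n, x ∉ ((insert a s).filter fun w => G.Adj a w).image χ := by
      by_contra hc
      push Not at hc
      have : Finset.range n ⊆ ((insert a s).filter fun w => G.Adj a w).image χ := hc
      have := Finset.card_le_card this
      rw [Finset.card_range] at this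
      have h3 := h a (Finset.mem_insert_self _ _)
      have h4 := Finset.card_image_le (s := (insert a s).filter fun w => G.Adj a w) (f := χ)
      omega
    obtain ⟨x, hx, hx'⟩ := this
    have hne : ∀ w ∈ s, G.Adj a w → χ w ≠ x := by
      intro w hw haw he
      apply hx'
      rw [Finset.mem_image]
      exact ⟨w, Finset.mem_filter.mpr ⟨Finset.mem_insert_of_mem hw, haw⟩, he⟩
    have hna : ∀ w ∈ s, w ≠ a := fun w hw he => ha (he ▸ hw)
    refine ⟨fun u => if u = a then x else χ u, ?_, ?_⟩
    · intro u hu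
      rcases Finset.mem_insert.mp hu with rfl | hu
      · simpa using hx
      · simpa [hna u hu] using h1 u hu
    · intro u hu w hw huw
      by_cases ea : u = a
      · by_cases eb : w = a
        · rw [ea, eb] at huw
          exact absurd huw (G.loopless.irrefl _)
        · have hw' := Finset.mem_of_mem_insert_of_ne hw eb
          simpa [ea, eb] using (hne w hw' (ea ▸ huw)).symm
      · have hu' := Finset.mem_of_mem_insert_of_ne hu ea
        by_cases eb : w = a
        · simpa [ea, eb] using hne u hu' (eb ▸ huw.symm)
        · have hw' := Finset.mem_of_mem_insert_of_ne hw eb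
          simpa [ea, eb] using h2 u hu' w hw' huw

lemma settail {p : ℝ} (n : ℕ) (hp0 : 0 ≤ p) (hp1 : p ≤ 1) (c : C) (z : ℕ) (S : Finset V)
    (k τ l σ : ℝ) (b : ℕ) (hb : 0 < b) (hl0 : 0 ≤ l) (hl1 : l ≤ 1)
    (hS : (((S ×ˢ S).filter fun q => G.Adj q.1 q.2).card : ℝ) ≤ 2 * k)
    (hτ : ∀ u ∈ S, Pr (gp G L p n) (fun ω => (Zs G L ω u c).card < z) ≤ τ) :
    Pr (gp G L p n) (fun ω => (1 - p) ^ z * S.card + (2 * k / b + 2 * l * S.card + b * σ) <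
      ((S.filter fun u => unc G L ω u c).card : ℝ)) ≤
      S.card * τ + b * Real.exp (-(l * σ)) := by
  have hv := gp_valid (G := G) (L := L) n hp0 hp1
  set H := S.filter fun u => b ≤ (S.filter fun w => G.Adj u w).card with hH
  set W := S.filter fun u => (S.filter fun w => G.Adj u w).card < b with hW
  have hHc : (H.card : ℝ) ≤ 2 * k / b := by
    rw [le_div_iff₀ (by positivity)]
    refine le_trans ?_ hS
    have e : ((S ×ˢ S).filter fun q => G.Adj q.1 q.2).card
        = ∑ u ∈ S, (S.filter fun w => G.Adj u w).card := by
      rw [← Finset.card_sigma]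
      apply Finset.card_bij (fun q _ => ⟨q.1, q.2⟩)
      · intro q hq
        simp only [Finset.mem_filter, Finset.mem_product] at hq
        simp [hq]
      · rintro ⟨a, b⟩ _ ⟨a', b'⟩ _ h
        simp at h; simp [h]
      · rintro ⟨a, b⟩ h
        simp only [Finset.mem_sigma, Finset.mem_filter] at h
        exact ⟨(a, b), by simp [h], rfl⟩
    rw [e]
    have h1 : H.card * b ≤ ∑ u ∈ H, (S.filter fun w => G.Adj u w).card := by
      have := Finset.card_nsmul_le_sum H (fun u => (S.filter fun w => G.Adj u w).card) b
        (fun u hu => (Finset.mem_filter.mp hu).2)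
      simpa using this
    have h2 : ∑ u ∈ H, (S.filter fun w => G.Adj u w).card
        ≤ ∑ u ∈ S, (S.filter fun w => G.Adj u w).card :=
      Finset.sum_le_sum_of_subset (Finset.filter_subset _ _)
    exact_mod_cast h1.trans h2
  obtain ⟨χ, hχ1, hχ2⟩ := greedy (G := G) b W (by
    intro u hu
    refine lt_of_le_of_lt ?_ (Finset.mem_filter.mp hu).2
    exact Finset.card_le_card (Finset.filter_subset_filter _ (Finset.filter_subset _ _)))
  set U := (1 - p) ^ z with hU
  have hU0 : 0 ≤ U := pow_nonneg (by linarith) _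
  let B : ℕ → Finset V := fun j => W.filter fun u => χ u = j
  have hsum : ∑ j ∈ Finset.range b, ((B j).card : ℝ) = W.card := by
    have := Finset.card_eq_sum_card_fiberwise (s := W) (t := Finset.range b) (f := χ)
      (fun u hu => by simpa using hχ1 u hu)
    exact_mod_cast this.symm
  have hWS : (W.card : ℝ) ≤ S.card := by exact_mod_cast Finset.card_le_card (Finset.filter_subset _ _)
  have step : Pr (gp G L p n) (fun ω => U * S.card + (2 * k / b + 2 * l * S.card + b * σ) <
      ((S.filter fun u => unc G L ω u c).card : ℝ)) ≤
      Pr (gp G L p n) (fun ω => (∃ u ∈ S, (Zs G L ω u c).card < z) ∨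
        ∃ j ∈ Finset.range b, U * (B j).card + 2 * l * (B j).card + σ <
      ∑ u ∈ B j, ind (unc G L ω u c ∧ z ≤ (Zs G L ω u c).card)) := by
    apply Pr_mono hv
    intro ω hω
    by_contra hcon
    push Not at hcon
    obtain ⟨c1, c2⟩ := hcon
    have h1 : ((S.filter fun u => unc G L ω u c).card : ℝ) ≤
        H.card + ∑ u ∈ W, ind (unc G L ω u c ∧ z ≤ (Zs G L ω u c).card) := by
      have : ((S.filter fun u => unc G L ω u c).card : ℝ) = ∑ u ∈ S, ind (unc G L ω u c) := by
        rw [Finset.card_filter]; push_cast; rfl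
      rw [this]
      have hsplit : ∑ u ∈ S, ind (unc G L ω u c) =
          ∑ u ∈ W, ind (unc G L ω u c) + ∑ u ∈ H, ind (unc G L ω u c) := by
        rw [hW, hH, ← Finset.sum_filter_add_sum_filter_not S
          (fun u => (S.filter fun w => G.Adj u w).card < b)]
        simp only [not_lt]
      rw [hsplit, add_comm]
      apply add_le_add
      · calc _ ≤ ∑ u ∈ H, (1:ℝ) := Finset.sum_le_sum fun u _ => ind_le_one _
          _ = _ := by simp
      · apply le_of_eq
        apply Finset.sum_congr rfl
        intro u hu
        have := c1 u (Finset.mem_filter.mp hu).1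
        simp [this]
    have h2 : ∑ u ∈ W, ind (unc G L ω u c ∧ z ≤ (Zs G L ω u c).card) =
        ∑ j ∈ Finset.range b, ∑ u ∈ B j, ind (unc G L ω u c ∧ z ≤ (Zs G L ω u c).card) := by
      symm
      apply Finset.sum_fiberwise_of_maps_to
      intro u hu
      simpa using hχ1 u hu
    have h3 : ∑ j ∈ Finset.range b, ∑ u ∈ B j, ind (unc G L ω u c ∧ z ≤ (Zs G L ω u c).card)
        ≤ ∑ j ∈ Finset.range b, (U * (B j).card + 2 * l * (B j).card + σ) :=
      Finset.sum_le_sum c2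
    rw [Finset.sum_add_distrib, Finset.sum_add_distrib, ← Finset.mul_sum, ← Finset.mul_sum, hsum]
      at h3
    simp only [Finset.sum_const, Finset.card_range, nsmul_eq_mul] at h3
    have h4 : U * W.card ≤ U * S.card := by gcongr
    have h5 : 2 * l * W.card ≤ 2 * l * S.card := by gcongr
    linarith
  refine step.trans ((Pr_or hv _ _).trans (add_le_add ?_ ?_))
  · refine (Pr_exists hv S _).trans ?_
    calc _ ≤ ∑ u ∈ S, τ := Finset.sum_le_sum hτ
      _ = _ := by simp
  · refine (Pr_exists hv _ _).trans ?_
    calc _ ≤ ∑ j ∈ Finset.range b, Real.exp (-(l * σ)) := by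
          apply Finset.sum_le_sum
          intro j _
          apply classtail n hp0 hp1 c z _ _ l σ hl0 hl1
          intro u hu w hw huw
          rw [Finset.mem_filter] at hu hw
          exact hχ2 u hu.1 w hw.1 huw (hu.2.trans hw.2.symm)
      _ = _ := by simp

lemma unc_congr {ω ω' : V × C × Bool → Bool} {u : V} {c : C}
    (h : ∀ i : V × C × Bool, i.2.1 ≠ c → ω i = ω' i) : unc G L ω u c = unc G L ω' u c := by
  have hZ : Zs G L ω u c = Zs G L ω' u c := by
    unfold Zs
    apply Finset.filter_congr
    intro c' hc'
    rw [kept_congr]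
    intro i hi
    apply h
    rw [kset_color hi]
    exact (Finset.mem_erase.mp hc').1
  unfold unc
  rw [hZ]
  apply propext
  apply forall₂_congr
  intro c' hc'
  rw [h]
  unfold Zs at hc'
  exact (Finset.mem_erase.mp (Finset.mem_filter.mp hc').1).1

/-- conditional version over the colour c -/
lemma degtail {p : ℝ} (n : ℕ) (hp0 : 0 ≤ p) (hp1 : p ≤ 1) (v : V) (c : C) (z : ℕ)
    (k A τ l σ : ℝ) (b : ℕ) (hb : 0 < b) (hl0 : 0 ≤ l) (hl1 : l ≤ 1) (hτ0 : 0 ≤ τ)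
    (hA : ((N G L v c).card : ℝ) ≤ A)
    (hS : (((N G L v c ×ˢ N G L v c).filter fun q => G.Adj q.1 q.2).card : ℝ) ≤ 2 * k)
    (hτ : ∀ u ∈ N G L v c, Pr (gp G L p n) (fun ω => (Zs G L ω u c).card < z) ≤ τ) :
    Pr (gp G L p n) (fun ω => (1 - p) ^ z * ((N G L v c).filter fun u => kept G L ω u c).card +
        (2 * k / b + 2 * l * A + b * σ) <
      (((N G L v c).filter fun u => kept G L ω u c ∧ unc G L ω u c).card : ℝ)) ≤
      A * τ + b * Real.exp (-(l * σ)) := by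
  have hv := gp_valid (G := G) (L := L) n hp0 hp1
  set S : Set (V × C × Bool) := {i | i.2.1 ≠ c} with hSdef
  unfold Pr
  rw [Ex_resample _ S]
  rw [← Ex_const (gp G L p n) (A * τ + b * Real.exp (-(l * σ)))]
  apply Ex_mono hv
  intro η
  set S0 := (N G L v c).filter fun u => kept G L η u c with hS0
  have hsub : S0 ⊆ N G L v c := Finset.filter_subset _ _
  have hcard : (S0.card : ℝ) ≤ A := le_trans (by exact_mod_cast Finset.card_le_card hsub) hA
  have main := settail (G := G) (L := L) n hp0 hp1 c z S0 k τ l σ b hb hl0 hl1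
    (le_trans (by
      exact_mod_cast Finset.card_le_card
        (Finset.filter_subset_filter _ (Finset.product_subset_product hsub hsub))) hS)
    (fun u hu => hτ u (hsub hu))
  refine le_trans (le_trans (Pr_mono hv ?_) main) ?_
  · intro τ' h
    have hk : ∀ u, kept G L (pw S τ' η) u c = kept G L η u c := by
      intro u
      apply kept_congr
      intro i hi
      have := kset_color hi
      simp [pw, hSdef, this]
    have hu : ∀ u, unc G L (pw S τ' η) u c = unc G L τ' u c := by
      intro u
      apply unc_congr
      intro i hi
      simp [pw, hSdef, hi]
    simp only [hk, hu] at h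
    rw [← Finset.filter_filter] at h
    have : 2 * l * S0.card ≤ 2 * l * A := by gcongr
    linarith
  · gcongr

lemma Ztail {p : ℝ} (n : ℕ) (hp0 : 0 ≤ p) (hp1 : p ≤ 1) (u : V) (c : C) (m δ : ℝ)
    (hδ0 : 0 ≤ δ) (hδ1 : δ ≤ 1)
    (hn : ∀ c' ∈ L u, (N G L u c').card ≤ n) (hm : m ≤ (L u).card) :
    Pr (gp G L p n) (fun ω => (Zs G L ω u c).card < ⌈(1 - δ) * ((1 - p) ^ n * (m - 1))⌉₊) ≤
      Real.exp (-(δ ^ 2 * ((1 - p) ^ n * (m - 1)) / 2)) := by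
  have hv := gp_valid (G := G) (L := L) n hp0 hp1
  refine le_trans (le_of_eq ?_) (chernoff hv (fun i : V × C × Bool => i.2.1) ((L u).erase c)
    (fun c' ω => ind (kept G L ω u c')) (fun c' _ => (dep_kept u c').ite)
    (fun c' _ ω => ⟨ind_nonneg _, ind_le_one _⟩) ((1 - p) ^ n * (m - 1)) δ hδ0 hδ1 ?_)
  · congr 1
    funext ω
    rw [Nat.lt_ceil]
    unfold Zs
    rw [Finset.card_filter]
    push_cast
    rfl
  · have : ∀ c' ∈ (L u).erase c, Ex (gp G L p n) (fun ω => ind (kept G L ω u c')) = (1 - p) ^ n :=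
      fun c' hc' => Pr_kept p n u c' (hn c' (Finset.mem_of_mem_erase hc'))
    rw [Finset.sum_congr rfl this, Finset.sum_const, nsmul_eq_mul, mul_comm]
    apply mul_le_mul_of_nonneg_right _ (pow_nonneg (by linarith) _)
    have h1 : (L u).card ≤ ((L u).erase c).card + 1 := by
      have := Finset.pred_card_le_card_erase (s := L u) (a := c)
      omega
    have : ((L u).card : ℝ) ≤ ((L u).erase c).card + 1 := by exact_mod_cast h1
    linarith

end Graph
end LC

namespace LC

section Step
variable {V C : Type} [Fintype V] [Fintype C] (G : SimpleGraph V) (L : V → Finset C)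

def Inv (A m : ℝ) : Prop :=
  (∀ v, ∀ c ∈ L v, ((N G L v c).card : ℝ) ≤ A) ∧
  ∀ v, (L v).Nonempty → m ≤ ∑ c ∈ L v, (1 - ((N G L v c).card : ℝ) / A)

def Sparse (k : ℝ) : Prop :=
  ∀ v, ∀ c ∈ L v, (((N G L v c ×ˢ N G L v c).filter fun q => G.Adj q.1 q.2).card : ℝ) ≤ 2 * k

def Col : Prop :=
  ∃ φ : V → C, ∀ v, (L v).Nonempty → φ v ∈ L v ∧ ∀ u, G.Adj v u → (L u).Nonempty → φ u ≠ φ v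

def L2 (ω : V × C × Bool → Bool) (v : V) : Finset C :=
  if ∃ c, colby G L ω v c then ∅ else (L v).filter fun c => kept G L ω v c

def L3 (A' : ℝ) (ω : V × C × Bool → Bool) (v : V) : Finset C :=
  (L2 G L ω v).filter fun c => ((N G (L2 G L ω) v c).card : ℝ) ≤ A'

def good (A' : ℝ) (ω : V × C × Bool → Bool) (v : V) (c : C) : ℝ :=
  ind (kept G L ω v c) * max 0 (1 - ((N G (L2 G L ω) v c).card : ℝ) / A')

variable {G L}

lemma N_mono {L' : V → Finset C} (h : ∀ v, L' v ⊆ L v) (v : V) (c : C) :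
    N G L' v c ⊆ N G L v c := by
  intro u hu
  rw [mem_N] at *
  exact ⟨hu.1, h u hu.2⟩

lemma Sparse.mono {L' : V → Finset C} (h : ∀ v, L' v ⊆ L v) {k : ℝ} (hs : Sparse G L k) :
    Sparse G L' k := by
  intro v c hc
  refine le_trans ?_ (hs v c (h v hc))
  exact_mod_cast Finset.card_le_card (Finset.filter_subset_filter _
    (Finset.product_subset_product (N_mono h v c) (N_mono h v c)))

lemma mem_L2 {ω : V × C × Bool → Bool} {v : V} {c : C} :
    c ∈ L2 G L ω v ↔ (¬ ∃ c, colby G L ω v c) ∧ c ∈ L v ∧ kept G L ω v c := by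
  unfold L2
  split_ifs with h
  · simp [h]
  · simp [h]

lemma mem_L3 {A' : ℝ} {ω : V × C × Bool → Bool} {v : V} {c : C} :
    c ∈ L3 G L A' ω v ↔ c ∈ L2 G L ω v ∧ ((N G (L2 G L ω) v c).card : ℝ) ≤ A' := by
  unfold L3
  simp

lemma L3_sub_L2 {A' : ℝ} {ω : V × C × Bool → Bool} (v : V) : L3 G L A' ω v ⊆ L2 G L ω v :=
  Finset.filter_subset _ _

lemma L2_sub {ω : V × C × Bool → Bool} (v : V) : L2 G L ω v ⊆ L v := by
  intro c hc
  exact (mem_L2.mp hc).2.1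

lemma sum_good {A' : ℝ} (hA' : 0 < A') {ω : V × C × Bool → Bool} {v : V}
    (hv : ¬ ∃ c, colby G L ω v c) :
    ∑ c ∈ L v, good G L A' ω v c =
      ∑ c ∈ L3 G L A' ω v, (1 - ((N G (L2 G L ω) v c).card : ℝ) / A') := by
  symm
  have hsub : L3 G L A' ω v ⊆ L v := fun c hc => L2_sub v (L3_sub_L2 v hc)
  rw [← Finset.sum_subset hsub (f := good G L A' ω v)]
  · apply Finset.sum_congr rfl
    intro c hc
    have h := mem_L3.mp hc
    have h2 := mem_L2.mp h.1
    unfold good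
    rw [ind_pos h2.2.2, one_mul, max_eq_right]
    rw [sub_nonneg, div_le_one hA']
    exact h.2
  · intro c hc hn
    unfold good
    by_cases hk : kept G L ω v c
    · have : ¬ ((N G (L2 G L ω) v c).card : ℝ) ≤ A' := fun h => hn (mem_L3.mpr ⟨mem_L2.mpr ⟨hv, hc, hk⟩, h⟩)
      push Not at this
      rw [max_eq_left, mul_zero]
      rw [sub_nonpos, one_le_div hA']
      exact this.le
    · rw [ind_neg hk, zero_mul]

lemma kept_apply {ω : V × C × Bool → Bool} {v u : V} {c : C} (h : kept G L ω v c)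
    (huv : G.Adj v u) (hc : c ∈ L u) : ω (u, c, false) = true := by
  apply h
  unfold kset
  exact Finset.mem_insert_of_mem (Finset.mem_image_of_mem _ (mem_N.mpr ⟨huv, hc⟩))

lemma step_det {A' m' : ℝ} (hA' : 0 < A') (hm' : 0 < m') (ω : V × C × Bool → Bool)
    (h : ∀ v, (L v).Nonempty → m' ≤ ∑ c ∈ L v, good G L A' ω v c) :
    Inv G (L3 G L A' ω) A' m' ∧ (Col G (L3 G L A' ω) → Col G L) := by
  have hsub : ∀ v, L3 G L A' ω v ⊆ L2 G L ω v := fun v => L3_sub_L2 v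
  have hN := fun v c => N_mono (G := G) hsub v c
  have hNc : ∀ v c, ((N G (L3 G L A' ω) v c).card : ℝ) ≤ (N G (L2 G L ω) v c).card :=
    fun v c => by exact_mod_cast Finset.card_le_card (hN v c)
  refine ⟨⟨?_, ?_⟩, ?_⟩
  · intro v c hc
    exact (hNc v c).trans (mem_L3.mp hc).2
  · rintro v ⟨c0, hc0⟩
    have h2 := mem_L2.mp (hsub v hc0)
    refine (h v ⟨c0, h2.2.1⟩).trans ?_
    rw [sum_good hA' h2.1]
    apply Finset.sum_le_sum
    intro c _
    have := hNc v c
    gcongr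
  · rintro ⟨φ, hφ⟩
    have hne : ∀ v, (L v).Nonempty → (¬ ∃ c, colby G L ω v c) → (L3 G L A' ω v).Nonempty := by
      intro v hv hc
      by_contra hemp
      rw [Finset.not_nonempty_iff_eq_empty] at hemp
      have := h v hv
      rw [sum_good hA' hc, hemp, Finset.sum_empty] at this
      linarith
    refine ⟨fun v => if hc : ∃ c, colby G L ω v c then hc.choose else φ v, ?_⟩
    intro v hv
    have main : ∀ v u, G.Adj v u → (hc : ∃ c, colby G L ω v c) → (L u).Nonempty →
        (¬ ∃ c, colby G L ω u c) → φ u ≠ hc.choose := by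
      intro v u huv hc hu hn he
      have h1 := hc.choose_spec
      have h2 := mem_L2.mp (hsub u (hφ u (hne u hu hn)).1)
      rw [he] at h2
      have := kept_apply h2.2.2 huv.symm h1.1
      rw [h1.2.1] at this
      simp at this
    constructor
    · by_cases hc : ∃ c, colby G L ω v c
      · simp only [hc, dif_pos]
        exact hc.choose_spec.1
      · simp only [hc, dif_neg, not_false_eq_true]
        exact (mem_L2.mp (hsub v (hφ v (hne v hv hc)).1)).2.1
    · intro u huv hu
      by_cases hc : ∃ c, colby G L ω v c <;> by_cases hc' : ∃ c, colby G L ω u c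
      · simp only [hc, hc', dif_pos]
        intro he
        have h1 := hc.choose_spec
        have h2 := hc'.choose_spec
        rw [he] at h2
        have := kept_apply h1.2.2 huv h2.1
        rw [h2.2.1] at this
        simp at this
      · simp only [hc, hc', dif_pos, dif_neg, not_false_eq_true]
        exact main v u huv hc hu hc'
      · simp only [hc, hc', dif_pos, dif_neg, not_false_eq_true]
        exact (main u v huv.symm hc' hv hc).symm
      · simp only [hc, hc', dif_neg, not_false_eq_true]
        exact (hφ v (hne v hv hc)).2 u huv (hne u hu hc')

lemma NL2_le (ω : V × C × Bool → Bool) (v : V) (c : C) :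
    (N G (L2 G L ω) v c).card ≤
      ((N G L v c).filter fun u => kept G L ω u c ∧ unc G L ω u c).card := by
  apply Finset.card_le_card
  intro u hu
  rw [mem_N, mem_L2] at hu
  rw [Finset.mem_filter, mem_N]
  refine ⟨⟨hu.1, hu.2.2.1⟩, hu.2.2.2, ?_⟩
  intro c' hc'
  unfold Zs at hc'
  rw [Finset.mem_filter] at hc'
  by_contra hn
  apply hu.2.1
  refine ⟨c', Finset.mem_of_mem_erase hc'.1, by simpa using hn, hc'.2⟩

/-! locality -/

variable (G L) in
def nb (v : V) : Finset V := insert v ((L v).biUnion fun c => N G L v c)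

lemma nb_symm {u v : V} (h : u ∈ nb G L v) : v ∈ nb G L u := by
  unfold nb at *
  rw [Finset.mem_insert, Finset.mem_biUnion] at *
  rcases h with h | ⟨c, hc, h⟩
  · exact Or.inl h.symm
  · rw [mem_N] at h
    exact Or.inr ⟨c, h.2, mem_N.mpr ⟨h.1.symm, hc⟩⟩

lemma kept_local {ω ω' : V × C × Bool → Bool} {v : V} (h : ∀ i : V × C × Bool, i.1 ∈ nb G L v → ω i = ω' i)
    {c : C} (hc : c ∈ L v) : kept G L ω v c = kept G L ω' v c := by
  apply kept_congr
  intro i hi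
  apply h
  simp only [kset, Finset.mem_insert, Finset.mem_image] at hi
  rcases hi with hi | ⟨a, ha, hi⟩
  · rw [hi]; exact Finset.mem_insert_self _ _
  · rw [← hi]
    exact Finset.mem_insert_of_mem (Finset.mem_biUnion.mpr ⟨c, hc, ha⟩)

lemma colby_local {ω ω' : V × C × Bool → Bool} {v : V} (h : ∀ i : V × C × Bool, i.1 ∈ nb G L v → ω i = ω' i)
    (c : C) : colby G L ω v c ↔ colby G L ω' v c := by
  unfold colby
  constructor
  · rintro ⟨h1, h2, h3⟩
    rw [kept_local h h1] at h3
    exact ⟨h1, (h _ (Finset.mem_insert_self _ _)).symm.trans h2, h3⟩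
  · rintro ⟨h1, h2, h3⟩
    rw [← kept_local h h1] at h3
    exact ⟨h1, (h _ (Finset.mem_insert_self _ _)).trans h2, h3⟩

lemma L2_local {ω ω' : V × C × Bool → Bool} {v : V} (h : ∀ i : V × C × Bool, i.1 ∈ nb G L v → ω i = ω' i) :
    L2 G L ω v = L2 G L ω' v := by
  ext c
  rw [mem_L2, mem_L2]
  simp only [colby_local h]
  constructor
  · rintro ⟨h1, h2, h3⟩
    rw [kept_local h h2] at h3
    exact ⟨h1, h2, h3⟩
  · rintro ⟨h1, h2, h3⟩
    rw [← kept_local h h2] at h3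
    exact ⟨h1, h2, h3⟩

lemma nb_card {v : V} {A D : ℝ} (hA : ∀ c ∈ L v, ((N G L v c).card : ℝ) ≤ A)
    (hL : ((L v).card : ℝ) ≤ D) (hAD : A ≤ D) (hA0 : 0 ≤ A) : ((nb G L v).card : ℝ) ≤ 1 + D ^ 2 := by
  have h1 : ((nb G L v).card : ℝ) ≤ ((L v).biUnion fun c => N G L v c).card + 1 := by
    exact_mod_cast Finset.card_insert_le _ _
  have h2 : (((L v).biUnion fun c => N G L v c).card : ℝ) ≤ ∑ c ∈ L v, ((N G L v c).card : ℝ) := by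
    exact_mod_cast Finset.card_biUnion_le
  have h3 : ∑ c ∈ L v, ((N G L v c).card : ℝ) ≤ (L v).card * A := by
    have := Finset.sum_le_sum hA
    simpa using this
  nlinarith [Nat.cast_nonneg (α := ℝ) (L v).card]

lemma biUnion_card_le {Q : ℝ} (hQ : ∀ v, ((nb G L v).card : ℝ) ≤ Q) (S : Finset V) :
    ((S.biUnion fun v => nb G L v).card : ℝ) ≤ S.card * Q := by
  have h2 : ((S.biUnion fun c => nb G L c).card : ℝ) ≤ ∑ c ∈ S, ((nb G L c).card : ℝ) := by
    exact_mod_cast Finset.card_biUnion_le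
  refine h2.trans ?_
  have := Finset.sum_le_sum (fun v (_ : v ∈ S) => hQ v)
  simpa using this

variable (G L) in
def loc (v : V) : Set (V × C × Bool) := {i | i.1 ∈ (nb G L v).biUnion fun u => nb G L u}

lemma loc_card {Q : ℝ} (hQ : ∀ v, ((nb G L v).card : ℝ) ≤ Q) (hQ0 : 0 ≤ Q) (v : V) :
    ((univ.filter fun v' => ¬ Disjoint (loc G L v) (loc G L v')).card : ℝ) ≤ Q ^ 4 := by
  set B1 := nb G L v with hB1
  set B2 := B1.biUnion fun u => nb G L u with hB2
  set B3 := B2.biUnion fun u => nb G L u with hB3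
  set B4 := B3.biUnion fun u => nb G L u with hB4
  have hsub : (univ.filter fun v' => ¬ Disjoint (loc G L v) (loc G L v')) ⊆ B4 := by
    intro v' hv'
    rw [Finset.mem_filter] at hv'
    rw [Set.not_disjoint_iff] at hv'
    obtain ⟨_, i, h1, h2⟩ := hv'
    have h1' : i.1 ∈ B2 := h1
    have h2' : i.1 ∈ (nb G L v').biUnion fun u => nb G L u := h2
    obtain ⟨w, hw, hw'⟩ := Finset.mem_biUnion.mp h2'
    rw [hB4, Finset.mem_biUnion]
    refine ⟨w, ?_, nb_symm hw⟩
    rw [hB3, Finset.mem_biUnion]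
    exact ⟨i.1, h1', nb_symm hw'⟩
  have h1 : (B1.card : ℝ) ≤ Q := hQ v
  have h2 := biUnion_card_le hQ B1
  have h3 := biUnion_card_le hQ B2
  have h4 := biUnion_card_le hQ B3
  have h5 : ((univ.filter fun v' => ¬ Disjoint (loc G L v) (loc G L v')).card : ℝ) ≤ B4.card := by
    exact_mod_cast Finset.card_le_card hsub
  calc _ ≤ (B4.card : ℝ) := h5
    _ ≤ B3.card * Q := h4
    _ ≤ (B2.card * Q) * Q := by gcongr
    _ ≤ ((B1.card * Q) * Q) * Q := by gcongr
    _ ≤ ((Q * Q) * Q) * Q := by gcongr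
    _ = Q ^ 4 := by ring

lemma nb_self (v : V) : v ∈ nb G L v := Finset.mem_insert_self _ _

lemma good_local {A' : ℝ} {ω ω' : V × C × Bool → Bool} {v : V}
    (h : ∀ i ∈ loc G L v, ω i = ω' i) {c : C} (hc : c ∈ L v) :
    good G L A' ω v c = good G L A' ω' v c := by
  have h1 : ∀ u ∈ nb G L v, ∀ i : V × C × Bool, i.1 ∈ nb G L u → ω i = ω' i :=
    fun u hu i hi => h i (Finset.mem_biUnion.mpr ⟨u, hu, hi⟩)
  unfold good
  rw [kept_local (h1 v (nb_self v)) hc]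
  have : N G (L2 G L ω) v c = N G (L2 G L ω') v c := by
    ext u
    rw [mem_N, mem_N]
    apply and_congr_right
    intro huv
    by_cases hu : c ∈ L u
    · rw [L2_local (h1 u ?_)]
      exact Finset.mem_insert_of_mem (Finset.mem_biUnion.mpr ⟨c, hc, mem_N.mpr ⟨huv, hu⟩⟩)
    · exact ⟨fun h => absurd (L2_sub _ h) hu, fun h => absurd (L2_sub _ h) hu⟩
  rw [this]

lemma dep_bad (A' m' : ℝ) (v : V) : Dep (loc G L v)
    (fun ω => (L v).Nonempty ∧ ∑ c ∈ L v, good G L A' ω v c < m') := by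
  intro ω ω' H
  have : ∑ c ∈ L v, good G L A' ω v c = ∑ c ∈ L v, good G L A' ω' v c :=
    Finset.sum_congr rfl (fun c hc => good_local H hc)
  beta_reduce
  rw [this]

/-! expectation -/

lemma pair_sum (v : V) (c : C) :
    ∑ u ∈ N G L v c, (N G L v c ∩ N G L u c).card =
      ((N G L v c ×ˢ N G L v c).filter fun q => G.Adj q.1 q.2).card := by
  symm
  rw [← Finset.card_sigma]
  apply Finset.card_bij (fun q _ => ⟨q.1, q.2⟩)
  · intro q hq
    simp only [Finset.mem_filter, Finset.mem_product] at hq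
    simp only [Finset.mem_sigma, Finset.mem_inter]
    exact ⟨hq.1.1, hq.1.2, mem_N.mpr ⟨hq.2, (mem_N.mp hq.1.2).2⟩⟩
  · rintro ⟨a, b⟩ _ ⟨a', b'⟩ _ h
    simp at h; simp [h]
  · rintro ⟨a, b⟩ h
    simp only [Finset.mem_sigma, Finset.mem_inter] at h
    exact ⟨(a, b), by simp [h, (mem_N.mp h.2.2).1], rfl⟩

lemma Pr_kept2_le {p : ℝ} (n : ℕ) (hp0 : 0 ≤ p) (hp1 : p ≤ 1) (hpn : p * n ≤ 1 / 2)
    (v u : V) (c : C) (h : (N G L v c).card ≤ n)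
    (h' : (N G L u c).card ≤ n) (huv : v ≠ u) :
    Pr (gp G L p n) (fun ω => kept G L ω v c ∧ kept G L ω u c) ≤
      (1 - p) ^ n * (1 - p) ^ n * (1 + 2 * p * (N G L v c ∩ N G L u c).card) := by
  have hv := gp_valid (G := G) (L := L) n hp0 hp1
  rw [← Pr_kept2 p n v u c h h' huv]
  set P := Pr (gp G L p n) (fun ω => kept G L ω v c ∧ kept G L ω u c) with hP
  have hP0 : 0 ≤ P := Pr_nonneg hv _
  set j := (N G L v c ∩ N G L u c).card with hj
  have hjn : (j : ℝ) ≤ n := by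
    exact_mod_cast (Finset.card_le_card Finset.inter_subset_left).trans h
  have hb : 1 - p * j ≤ (1 - p) ^ j := by
    have := one_add_mul_le_pow (a := -p) (by linarith) j
    rw [← sub_eq_add_neg] at this
    linarith
  have hpj : p * j ≤ 1 / 2 := le_trans (by gcongr) hpn
  have hpj0 : 0 ≤ p * j := by positivity
  have : 1 ≤ (1 - p) ^ j * (1 + 2 * p * j) := by
    calc (1:ℝ) ≤ (1 - p * j) * (1 + 2 * p * j) := by nlinarith
      _ ≤ _ := by
        apply mul_le_mul_of_nonneg_right hb
        linarith
  nlinarith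

lemma Ex_good {p A A' k δ U : ℝ} (n : ℕ) (hp0 : 0 ≤ p) (hp1 : p ≤ 1) (hpn : p * n ≤ 1 / 2)
    (hA : 0 < A) (hδ0 : 0 ≤ δ) (hU : 0 ≤ U) (hKU : 1 / 2 ≤ (1 - p) ^ n * U)
    (hA' : A' = (1 - p) ^ n * U * A * (1 + 4 * δ)) (hpk : 4 * p * k ≤ δ * A)
    (v : V) (c : C) (hc : c ∈ L v) (hn : ∀ v, ∀ c ∈ L v, (N G L v c).card ≤ n)
    (hS : Sparse G L k) :
    (1 - p) ^ n / (1 + 4 * δ) * (1 - ((N G L v c).card : ℝ) / A) ≤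
    Ex (gp G L p n) (fun ω => ind (kept G L ω v c) *
      max 0 (1 - (U * ((N G L v c).filter fun u => kept G L ω u c).card + δ * A) / A')) := by
  have hv := gp_valid (G := G) (L := L) n hp0 hp1
  set K := (1 - p) ^ n with hK
  have hK0 : 0 ≤ K := pow_nonneg (by linarith) _
  have hKU0 : 0 < K * U := by linarith
  have hA'0 : 0 < A' := by rw [hA']; positivity
  have hKpos : 0 < K := by
    rcases hK0.eq_or_lt with h | h
    · rw [← h] at hKU0; simp at hKU0
    · exact h
  set deg : ℝ := ((N G L v c).card : ℝ) with hdeg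
  have hdeg0 : 0 ≤ deg := by positivity
  have hsum : ∑ u ∈ N G L v c, Pr (gp G L p n) (fun ω => kept G L ω v c ∧ kept G L ω u c)
      ≤ K * K * (deg + δ * A) := by
    calc _ ≤ ∑ u ∈ N G L v c, K * K * (1 + 2 * p * (N G L v c ∩ N G L u c).card) := by
          apply Finset.sum_le_sum
          intro u hu
          have hu' := mem_N.mp hu
          exact Pr_kept2_le n hp0 hp1 hpn v u c (hn v c hc) (hn u c hu'.2) hu'.1.ne
      _ = K * K * (deg + 2 * p * ∑ u ∈ N G L v c, ((N G L v c ∩ N G L u c).card : ℝ)) := by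
          rw [← Finset.mul_sum, Finset.sum_add_distrib, Finset.mul_sum, Finset.sum_const,
            nsmul_eq_mul, mul_one]
      _ ≤ _ := by
          have h1 : ∑ u ∈ N G L v c, ((N G L v c ∩ N G L u c).card : ℝ) ≤ 2 * k := by
            refine le_trans (le_of_eq ?_) (hS v c hc)
            exact_mod_cast pair_sum v c
          have h2 : 2 * p * ∑ u ∈ N G L v c, ((N G L v c ∩ N G L u c).card : ℝ) ≤ 2 * p * (2 * k) := by
            gcongr
          apply mul_le_mul_of_nonneg_left _ (mul_nonneg hK0 hK0)
          linarith
  have hlow : Ex (gp G L p n) (fun ω => (1 - δ * A / A') * ind (kept G L ω v c) -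
      (U / A') * ∑ u ∈ N G L v c, ind (kept G L ω v c ∧ kept G L ω u c)) ≤
      Ex (gp G L p n) (fun ω => ind (kept G L ω v c) *
      max 0 (1 - (U * ((N G L v c).filter fun u => kept G L ω u c).card + δ * A) / A')) := by
    apply Ex_mono hv
    intro ω
    by_cases hk : kept G L ω v c
    · rw [ind_pos hk]
      have : (((N G L v c).filter fun u => kept G L ω u c).card : ℝ) =
          ∑ u ∈ N G L v c, ind (kept G L ω v c ∧ kept G L ω u c) := by
        simp only [hk, true_and]
        rw [Finset.card_filter]; push_cast; rfl
      rw [← this, one_mul]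
      refine le_trans (le_of_eq ?_) (le_max_right _ _)
      field_simp
      ring
    · simp [ind_neg hk, hk, ind]
  refine le_trans ?_ hlow
  rw [Ex_sub, Ex_smul, Ex_smul, Ex_sum]
  have e1 : Ex (gp G L p n) (fun ω => ind (kept G L ω v c)) = K := Pr_kept p n v c (hn v c hc)
  rw [e1]
  have h3 : U / A' * ∑ u ∈ N G L v c, Ex (gp G L p n) (fun ω => ind (kept G L ω v c ∧ kept G L ω u c))
      ≤ U / A' * (K * K * (deg + δ * A)) := by
    apply mul_le_mul_of_nonneg_left hsum
    positivity
  have h4 : U / A' * (K * K * (deg + δ * A)) = K / (1 + 4 * δ) * (deg / A + δ) := by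
    rw [hA']
    have : U ≠ 0 := by rintro rfl; simp at hKU0
    field_simp
  have h5 : δ * A / A' ≤ 2 * δ / (1 + 4 * δ) := by
    rw [hA', div_le_div_iff₀ (by positivity) (by positivity)]
    have : 0 ≤ δ * A * (1 + 4 * δ) := by positivity
    nlinarith
  have h6 : (1 - 2 * δ / (1 + 4 * δ)) * K ≤ (1 - δ * A / A') * K := by gcongr
  have h7 : K / (1 + 4 * δ) * (1 - deg / A) ≤
      (1 - 2 * δ / (1 + 4 * δ)) * K - K / (1 + 4 * δ) * (deg / A + δ) := by
    have : (1 - 2 * δ / (1 + 4 * δ)) * K - K / (1 + 4 * δ) * (deg / A + δ)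
        - K / (1 + 4 * δ) * (1 - deg / A) = K / (1 + 4 * δ) * δ := by
      field_simp
      ring
    have h8 : 0 ≤ K / (1 + 4 * δ) * δ := by positivity
    linarith
  linarith

lemma bad_prob {p A A' m k δ l σ D : ℝ} (n b z : ℕ) (hp0 : 0 ≤ p) (hp1 : p ≤ 1)
    (hpn : p * n ≤ 1 / 2)
    (hA : 0 < A) (hnA : (n : ℝ) ≤ A) (hδ0 : 0 ≤ δ) (hδ1 : δ ≤ 1)
    (hz : z = ⌈(1 - δ) * ((1 - p) ^ n * (m - 1))⌉₊)
    (hKU : 1 / 2 ≤ (1 - p) ^ n * (1 - p) ^ z)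
    (hA' : A' = (1 - p) ^ n * (1 - p) ^ z * A * (1 + 4 * δ)) (hpk : 4 * p * k ≤ δ * A)
    (hb : 0 < b) (hl0 : 0 ≤ l) (hl1 : l ≤ 1)
    (herr : 2 * k / b + 2 * l * A + b * σ ≤ δ * A)
    (hn : ∀ v, ∀ c ∈ L v, (N G L v c).card ≤ n)
    (hI : Inv G L A m) (hS : Sparse G L k) (hD : ∀ v, ((L v).card : ℝ) ≤ D)
    (v : V) (hne : (L v).Nonempty) :
    Pr (gp G L p n) (fun ω => ∑ c ∈ L v, good G L A' ω v c <
      (1 - δ) * ((1 - p) ^ n / (1 + 4 * δ) * m)) ≤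
      D * (A * Real.exp (-(δ ^ 2 * ((1 - p) ^ n * (m - 1)) / 2)) + b * Real.exp (-(l * σ)))
      + Real.exp (-(δ ^ 2 * ((1 - p) ^ n / (1 + 4 * δ) * m) / 2)) := by
  have hv := gp_valid (G := G) (L := L) n hp0 hp1
  set K := (1 - p) ^ n with hK
  set U := (1 - p) ^ z with hU
  have hK0 : 0 ≤ K := pow_nonneg (by linarith) _
  have hU0 : 0 ≤ U := pow_nonneg (by linarith) _
  have hA'0 : 0 < A' := by
    rw [hA']
    have : 0 < K * U := by linarith
    positivity
  set τ := Real.exp (-(δ ^ 2 * (K * (m - 1)) / 2)) with hτ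
  set f : C → (V × C × Bool → Bool) → ℝ := fun c ω => ind (kept G L ω v c) *
      max 0 (1 - (U * ((N G L v c).filter fun u => kept G L ω u c).card + δ * A) / A') with hf
  have hcard : ∀ u, (L u).Nonempty → m ≤ (L u).card := by
    intro u hu
    refine (hI.2 u hu).trans ?_
    calc _ ≤ ∑ c ∈ L u, (1:ℝ) := by
          apply Finset.sum_le_sum
          intro c _
          have : 0 ≤ ((N G L u c).card : ℝ) / A := by positivity
          linarith
      _ = _ := by simp
  let E : C → (V × C × Bool → Bool) → Prop := fun c ω =>
    U * ((N G L v c).filter fun u => kept G L ω u c).card +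
        (2 * k / b + 2 * l * A + b * σ) <
      (((N G L v c).filter fun u => kept G L ω u c ∧ unc G L ω u c).card : ℝ)
  calc _ ≤ Pr (gp G L p n) (fun ω => (∃ c ∈ L v, E c ω) ∨
        ∑ c ∈ L v, f c ω < (1 - δ) * (K / (1 + 4 * δ) * m)) := by
        apply Pr_mono hv
        intro ω hω
        by_contra hcon
        push Not at hcon
        obtain ⟨c1, c2⟩ := hcon
        have : ∑ c ∈ L v, f c ω ≤ ∑ c ∈ L v, good G L A' ω v c := by
          apply Finset.sum_le_sum
          intro c hc
          have h1 := c1 c hc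
          simp only [E, not_lt] at h1
          have h2 : ((N G (L2 G L ω) v c).card : ℝ) ≤
            (((N G L v c).filter fun u => kept G L ω u c ∧ unc G L ω u c).card : ℝ) := by
            exact_mod_cast NL2_le ω v c
          simp only [hf, good]
          apply mul_le_mul_of_nonneg_left _ (ind_nonneg _)
          apply max_le_max le_rfl
          have : ((N G (L2 G L ω) v c).card : ℝ) ≤
            U * ((N G L v c).filter fun u => kept G L ω u c).card + δ * A := by linarith
          gcongr
        linarith
    _ ≤ _ := by
        refine (Pr_or hv _ _).trans (add_le_add ?_ ?_)
        · refine (Pr_exists hv _ _).trans ?_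
          have hτ0 : 0 ≤ τ := (Real.exp_pos _).le
          calc _ ≤ ∑ c ∈ L v, (A * τ + b * Real.exp (-(l * σ))) := by
                apply Finset.sum_le_sum
                intro c hc
                apply degtail n hp0 hp1 v c z k A τ l σ b hb hl0 hl1 hτ0 (hI.1 v c hc) (hS v c hc)
                intro u hu
                rw [hz]
                exact Ztail n hp0 hp1 u c m δ hδ0 hδ1 (hn u) (hcard u ⟨c, (mem_N.mp hu).2⟩)
            _ = (L v).card * (A * τ + b * Real.exp (-(l * σ))) := by rw [Finset.sum_const, nsmul_eq_mul]
            _ ≤ _ := by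
                apply mul_le_mul_of_nonneg_right (hD v)
                positivity
        · apply chernoff hv (fun i : V × C × Bool => i.2.1)
          · intro c _ ω ω' H
            have hk : ∀ u, kept G L ω u c = kept G L ω' u c := fun u => dep_kept u c ω ω' H
            simp only [hf, hk]
          · intro c _ ω
            have h1 := ind_nonneg (kept G L ω v c)
            have h2 := ind_le_one (kept G L ω v c)
            have h3 : 0 ≤ max 0 (1 - (U * ((N G L v c).filter fun u => kept G L ω u c).card + δ * A) / A') :=
              le_max_left _ _
            have h4 : max 0 (1 - (U * ((N G L v c).filter fun u => kept G L ω u c).card + δ * A) / A') ≤ 1 := by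
              apply max_le (by norm_num)
              have : 0 ≤ (U * ((N G L v c).filter fun u => kept G L ω u c).card + δ * A) / A' := by
                positivity
              linarith
            exact ⟨mul_nonneg h1 h3, mul_le_one₀ h2 h3 h4⟩
          · exact hδ0
          · exact hδ1
          · calc _ ≤ K / (1 + 4 * δ) * ∑ c ∈ L v, (1 - ((N G L v c).card : ℝ) / A) := by
                  apply mul_le_mul_of_nonneg_left (hI.2 v hne)
                  positivity
              _ = ∑ c ∈ L v, K / (1 + 4 * δ) * (1 - ((N G L v c).card : ℝ) / A) := Finset.mul_sum _ _ _
              _ ≤ _ := by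
                  apply Finset.sum_le_sum
                  intro c hc
                  exact Ex_good n hp0 hp1 hpn hA hδ0 hU0 hKU hA' hpk v c hc hn hS

lemma step {p A A' m k δ l σ D x : ℝ} (n b z : ℕ) (hp0 : 0 ≤ p) (hp1 : p ≤ 1)
    (hpA : p * A ≤ 1 / 2) (hA : 0 < A) (hnA : n = ⌊A⌋₊) (hδ0 : 0 ≤ δ) (hδ1 : δ < 1) (hm : 0 < m)
    (hz : z = ⌈(1 - δ) * ((1 - p) ^ n * (m - 1))⌉₊)
    (hKU : 1 / 2 ≤ (1 - p) ^ n * (1 - p) ^ z)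
    (hA' : A' = (1 - p) ^ n * (1 - p) ^ z * A * (1 + 4 * δ)) (hpk : 4 * p * k ≤ δ * A)
    (hb : 0 < b) (hl0 : 0 ≤ l) (hl1 : l ≤ 1)
    (herr : 2 * k / b + 2 * l * A + b * σ ≤ δ * A)
    (hI : Inv G L A m) (hS : Sparse G L k) (hD : ∀ v, ((L v).card : ℝ) ≤ D) (hAD : A ≤ D)
    (hx : D * (A * Real.exp (-(δ ^ 2 * ((1 - p) ^ n * (m - 1)) / 2)) + b * Real.exp (-(l * σ)))
      + Real.exp (-(δ ^ 2 * ((1 - p) ^ n / (1 + 4 * δ) * m) / 2)) ≤ x)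
    (hxQ : 4 * x * (1 + D ^ 2) ^ 4 ≤ 1) :
    ∃ L' : V → Finset C, (∀ v, L' v ⊆ L v) ∧
      Inv G L' A' ((1 - δ) * ((1 - p) ^ n / (1 + 4 * δ) * m)) ∧ (Col G L' → Col G L) := by
  have hv := gp_valid (G := G) (L := L) n hp0 hp1
  have hnA' : (n : ℝ) ≤ A := by rw [hnA]; exact Nat.floor_le hA.le
  have hpn : p * n ≤ 1 / 2 := le_trans (by gcongr) hpA
  have hn : ∀ v, ∀ c ∈ L v, (N G L v c).card ≤ n := by
    intro v c hc
    rw [hnA]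
    exact Nat.le_floor (hI.1 v c hc)
  have hK0 : 0 ≤ (1 - p) ^ n := pow_nonneg (by linarith) _
  have hKU0 : 0 < (1 - p) ^ n * (1 - p) ^ z := by linarith
  have hKpos : 0 < (1 - p) ^ n := by
    rcases hK0.eq_or_lt with h | h
    · rw [← h] at hKU0; simp at hKU0
    · exact h
  have hA'0 : 0 < A' := by rw [hA']; positivity
  have hD0 : 0 ≤ D := hA.le.trans hAD
  have hx0 : 0 ≤ x := le_trans (by positivity) hx
  have hm' : 0 < (1 - δ) * ((1 - p) ^ n / (1 + 4 * δ) * m) := by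
    have : 0 < 1 - δ := by linarith
    positivity
  have hQ1 : 1 ≤ (1 + D ^ 2) ^ 4 := one_le_pow₀ (by nlinarith)
  obtain ⟨ω, hω⟩ := lll hv (fun v ω => (L v).Nonempty ∧ ∑ c ∈ L v, good G L A' ω v c <
      (1 - δ) * ((1 - p) ^ n / (1 + 4 * δ) * m)) (loc G L) (dep_bad A' _) x ((1 + D ^ 2) ^ 4)
      (by
        intro v
        by_cases hne : (L v).Nonempty
        · refine le_trans (Pr_mono hv fun ω h => h.2) (le_trans ?_ hx)
          exact bad_prob n b z hp0 hp1 hpn hA hnA' hδ0 hδ1.le hz hKU hA' hpk hb hl0 hl1 herr hn hI hS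
            hD v hne
        · have : (fun ω : V × C × Bool → Bool => (L v).Nonempty ∧ ∑ c ∈ L v, good G L A' ω v c <
              (1 - δ) * ((1 - p) ^ n / (1 + 4 * δ) * m)) = fun _ => False := by
            funext ω; simp [hne]
          rw [this]
          unfold Pr
          rw [Ex_const, ind_neg (by simp)]
          exact hx0)
      (by
        intro v
        exact loc_card (fun v => nb_card (hI.1 v) (hD v) hAD hA.le) (by positivity) v)
      hx0 hxQ (by nlinarith)
  have := step_det hA'0 hm' ω (fun v hne => by
    by_contra hlt
    push Not at hlt
    exact hω v ⟨hne, hlt⟩)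
  exact ⟨_, fun v => (L3_sub_L2 v).trans (L2_sub v), this.1, this.2⟩

end Step
end LC

namespace LC

section Fin
variable {V C : Type} [Fintype V] [Fintype C] {G : SimpleGraph V} {L : V → Finset C}

lemma Inv.card_ge {A m : ℝ} (hA : 0 < A) (hI : Inv G L A m) {u : V} (hu : (L u).Nonempty) :
    m ≤ (L u).card := by
  refine (hI.2 u hu).trans ?_
  calc _ ≤ ∑ c ∈ L u, (1:ℝ) := by
        apply Finset.sum_le_sum
        intro c _
        have : 0 ≤ ((N G L u c).card : ℝ) / A := by positivity
        linarith
    _ = _ := by simp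

lemma finish [Nonempty C] {A m D x : ℝ} (hA : 0 < A) (hm : 1 ≤ m) (hI : Inv G L A m)
    (hD : ∀ v, ((L v).card : ℝ) ≤ D) (hAD : A ≤ D)
    (hx : Real.exp (-((m - 1) / 16)) + Real.exp (-((m - 1) / (8 * (A + 1)))) ≤ x)
    (hxQ : 4 * x * (1 + D ^ 2) ^ 4 ≤ 1) : Col G L := by
  set p : ℝ := 1 / (2 * (A + 1)) with hp
  have hp0 : 0 ≤ p := by positivity
  have hpA : p * (A + 1) = 1 / 2 := by rw [hp]; field_simp
  have hp1 : p ≤ 1 / 2 := by nlinarith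
  set n := ⌊A⌋₊ with hn
  have hnA : (n : ℝ) ≤ A := Nat.floor_le hA.le
  have hv := gp_valid (G := G) (L := L) (p := p) n hp0 (by linarith)
  have hnn : ∀ v, ∀ c ∈ L v, (N G L v c).card ≤ n := by
    intro v c hc
    exact Nat.le_floor (hI.1 v c hc)
  set K := (1 - p) ^ n with hK
  have hKh : 1 / 2 ≤ K := by
    have := one_add_mul_le_pow (a := -p) (by linarith) n
    rw [← sub_eq_add_neg] at this
    have h2 : p * n ≤ p * A := by gcongr
    rw [hK]
    nlinarith
  set z := ⌈(1 - (1/2 : ℝ)) * (K * (m - 1))⌉₊ with hz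
  have hzge : (m - 1) / 4 ≤ z := by
    refine le_trans ?_ (Nat.le_ceil _)
    nlinarith
  have hx0 : 0 ≤ x := le_trans (by positivity) hx
  have hQ1 : 1 ≤ (1 + D ^ 2) ^ 4 := one_le_pow₀ (by nlinarith)
  obtain ⟨ω, hω⟩ := lll hv (fun v ω => (L v).Nonempty ∧ ¬ ∃ c, colby G L ω v c) (loc G L)
    (by
      intro v ω ω' H
      have h1 : ∀ i : V × C × Bool, i.1 ∈ nb G L v → ω i = ω' i :=
        fun i hi => H i (Finset.mem_biUnion.mpr ⟨v, nb_self v, hi⟩)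
      simp only [colby_local h1])
    x ((1 + D ^ 2) ^ 4)
    (by
      intro v
      by_cases hne : (L v).Nonempty
      · obtain ⟨c, hc⟩ := hne
        refine le_trans (Pr_mono (B := fun ω => (Zs G L ω v c).card < z ∨
          ∀ u ∈ ({v} : Finset V), unc G L ω u c ∧ z ≤ (Zs G L ω u c).card) hv ?_) (le_trans (Pr_or hv _ _)
            (le_trans (add_le_add ?_ ?_) hx))
        · intro ω h
          by_cases hlt : (Zs G L ω v c).card < z
          · exact Or.inl hlt
          · right
            intro u hu
            rw [Finset.mem_singleton] at hu
            rw [hu]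
            refine ⟨?_, not_lt.mp hlt⟩
            intro c' hc'
            unfold Zs at hc'
            rw [Finset.mem_filter] at hc'
            by_contra hn
            exact h.2 ⟨c', Finset.mem_of_mem_erase hc'.1, by simpa using hn, hc'.2⟩
        · refine (Ztail n hp0 (by linarith) v c m (1/2) (by norm_num) (by norm_num) (hnn v)
            (hI.card_ge hA ⟨c, hc⟩)).trans ?_
          rw [Real.exp_le_exp]
          nlinarith
        · refine (core n hp0 (by linarith) c z {v} ?_).trans ?_
          · intro u hu w hw huw
            rw [Finset.mem_singleton] at hu hw
            rw [hu, hw] at huw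
            exact G.loopless.irrefl _ huw
          · rw [Finset.card_singleton, pow_one]
            calc (1 - p) ^ z ≤ (Real.exp (-p)) ^ z := by
                  apply pow_le_pow_left₀ (by linarith)
                  linarith [Real.add_one_le_exp (-p)]
              _ = Real.exp (z * (-p)) := (Real.exp_nat_mul _ _).symm
              _ ≤ _ := by
                  rw [Real.exp_le_exp]
                  have h1 : (m - 1) / 4 * p ≤ z * p := by gcongr
                  have h2 : (m - 1) / 4 * p = (m - 1) / (8 * (A + 1)) := by
                    rw [hp]; field_simp; ring
                  linarith
      · have : (fun ω : V × C × Bool → Bool => (L v).Nonempty ∧ ¬ ∃ c, colby G L ω v c)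
            = fun _ => False := by
          funext ω; simp [hne]
        rw [this]
        unfold Pr
        rw [Ex_const, ind_neg (by simp)]
        exact hx0)
    (by
      intro v
      exact loc_card (fun v => nb_card (hI.1 v) (hD v) hAD hA.le) (by positivity) v)
    hx0 hxQ (by nlinarith)
  have hc : ∀ v, (L v).Nonempty → ∃ c, colby G L ω v c := by
    intro v hv
    by_contra h
    exact hω v ⟨hv, h⟩
  refine ⟨fun v => if hv : (L v).Nonempty then (hc v hv).choose else Classical.arbitrary C, ?_⟩
  intro v hv
  simp only [hv, dif_pos]
  refine ⟨(hc v hv).choose_spec.1, ?_⟩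
  intro u huv hu
  simp only [hu, dif_pos]
  intro he
  have h1 := (hc v hv).choose_spec
  have h2 := (hc u hu).choose_spec
  rw [he] at h2
  have := kept_apply h1.2.2 huv h2.1
  rw [h2.2.1] at this
  simp at this

end Fin

/-! numerics -/

lemma exp_neg_le {y : ℝ} (h0 : 0 ≤ y) (h1 : y ≤ 1) : Real.exp (-y) ≤ 1 - y + y ^ 2 := by
  have := Real.abs_exp_sub_one_sub_id_le (x := -y) (by rw [abs_neg, abs_of_nonneg h0]; exact h1)
  have := le_abs_self (Real.exp (-y) - 1 - -y)
  nlinarith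

lemma num1 {θ p A m δ K U : ℝ} {n z : ℕ} (hθ0 : 0 < θ) (hθ1 : θ ≤ 1 / 32) (hA : 0 < A) (hm : 1 ≤ m)
    (hp : p = θ / (A + m)) (hδ0 : 0 < δ) (h1 : 10 * δ ≤ p * m * θ) (h3 : 1 ≤ δ * m)
    (hn : n = ⌊A⌋₊) (hK : K = (1 - p) ^ n) (hz : z = ⌈(1 - δ) * (K * (m - 1))⌉₊)
    (hU : U = (1 - p) ^ z) :
    0 < p ∧ p * A + p * m = θ ∧ p ≤ θ ∧ 1 - p * A ≤ K ∧ K ≤ 1 ∧ 1 - p * m ≤ U ∧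
      U ≤ 1 - p * m * (1 - 3 * θ) := by
  have hm0 : 0 < m := by linarith
  have hp0 : 0 < p := by rw [hp]; positivity
  have hsum : p * A + p * m = θ := by rw [hp]; field_simp
  have hpA0 : 0 < p * A := by positivity
  have hpm0 : 0 < p * m := by positivity
  have hpθ : p ≤ θ := by nlinarith
  have hnA : (n : ℝ) ≤ A := by rw [hn]; exact Nat.floor_le hA.le
  have hK1 : 1 - p * A ≤ K := by
    have := one_add_mul_le_pow (a := -p) (by linarith) n
    rw [← sub_eq_add_neg] at this
    have h2 : p * n ≤ p * A := by gcongr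
    rw [hK]; linarith
  have hK2 : K ≤ 1 := by rw [hK]; exact pow_le_one₀ (by linarith) (by linarith)
  have hδθ : 2 * δ ≤ θ := by nlinarith
  have hzle : (z : ℝ) ≤ m := by
    have h5 : 0 ≤ (1 - δ) * (K * (m - 1)) := by
      apply mul_nonneg (by linarith) (mul_nonneg (by linarith) (by linarith))
    have h6 := Nat.ceil_lt_add_one h5
    rw [← hz] at h6
    have h7 : (1 - δ) * (K * (m - 1)) ≤ 1 * (1 * (m - 1)) := by
      apply mul_le_mul (by linarith) _ (mul_nonneg (by linarith) (by linarith)) (by norm_num)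
      apply mul_le_mul_of_nonneg_right hK2 (by linarith)
    linarith
  have hzge : (1 - δ) * (K * (m - 1)) ≤ z := by rw [hz]; exact Nat.le_ceil _
  have hzge2 : m * (1 - 2 * θ) ≤ z := by
    refine le_trans ?_ hzge
    have e1 : (1 - θ) * (m * (1 - δ)) ≤ K * (m - 1) := by
      apply mul_le_mul (by linarith) (by linarith) (mul_nonneg hm0.le (by linarith)) (by linarith)
    have e2 : (1 - δ) * ((1 - θ) * (m * (1 - δ))) ≤ (1 - δ) * (K * (m - 1)) :=
      mul_le_mul_of_nonneg_left e1 (by linarith)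
    refine le_trans ?_ e2
    have e3 : (1 - 2 * θ) ≤ (1 - δ) * (1 - θ) * (1 - δ) := by nlinarith [mul_pos hδ0 hθ0, mul_pos hδ0 hδ0]
    nlinarith
  have hU1 : 1 - p * m ≤ U := by
    have := one_add_mul_le_pow (a := -p) (by linarith) z
    rw [← sub_eq_add_neg] at this
    have h2 : p * z ≤ p * m := by gcongr
    rw [hU]; linarith
  refine ⟨hp0, hsum, hpθ, hK1, hK2, hU1, ?_⟩
  set y := p * m * (1 - 2 * θ) with hy
  have hy0 : 0 ≤ y := mul_nonneg hpm0.le (by linarith)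
  have hy1 : y ≤ p * m := by nlinarith
  calc U ≤ (Real.exp (-p)) ^ z := by
        rw [hU]
        apply pow_le_pow_left₀ (by linarith)
        linarith [Real.add_one_le_exp (-p)]
    _ = Real.exp (z * (-p)) := (Real.exp_nat_mul _ _).symm
    _ ≤ Real.exp (-y) := by
        rw [Real.exp_le_exp]
        have : p * (m * (1 - 2 * θ)) ≤ p * z := by gcongr
        nlinarith
    _ ≤ 1 - y + y ^ 2 := exp_neg_le hy0 (by linarith)
    _ ≤ _ := by
        have : y ^ 2 ≤ (p * m) * θ := by
          rw [sq]
          apply mul_le_mul hy1 (by linarith) hy0 hpm0.le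
        rw [hy] at *
        nlinarith

lemma num2 {θ p A m δ K U A' m' : ℝ} (hθ0 : 0 < θ) (hθ1 : θ ≤ 1 / 32) (hA : 0 < A) (hm : 1 ≤ m)
    (hp0 : 0 < p) (hsum : p * A + p * m = θ) (hK1 : 1 - p * A ≤ K) (hK2 : K ≤ 1)
    (hU1 : 1 - p * m ≤ U) (hU2 : U ≤ 1 - p * m * (1 - 3 * θ))
    (hδ0 : 0 < δ) (h1 : 10 * δ ≤ p * m * θ) (h2 : 5 * δ ≤ p * A * θ)
    (hA' : A' = K * U * A * (1 + 4 * δ)) (hm' : m' = (1 - δ) * (K / (1 + 4 * δ) * m)) :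
    0 < A' ∧ 0 < m' ∧ A' ≤ A ∧ m' ≤ (1 - δ) * m ∧ A' / m' ≤ A / m ∧ 1 / 2 ≤ K * U ∧
      m * Real.exp (-((1 + 16 * θ) * (A / m - A' / m'))) ≤ m' := by
  have hm0 : 0 < m := by linarith
  have hpA0 : 0 < p * A := by positivity
  have hpm0 : 0 < p * m := by positivity
  have hδθ : δ ≤ 1 / 1000 := by nlinarith
  have hK0 : 0 < K := by linarith
  have hU0 : 0 < U := by linarith
  have hA'0 : 0 < A' := by rw [hA']; positivity
  have h1δ : 0 < 1 - δ := by linarith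
  have hm'0 : 0 < m' := by rw [hm']; positivity
  have hUle : U * (1 + 10 * δ) ≤ 1 - p * m * (1 - 4 * θ) := by
    have : U * (1 + 10 * δ) ≤ (1 - p * m * (1 - 3 * θ)) * (1 + 10 * δ) := by gcongr
    have h9 : 0 ≤ p * m * (1 - 3 * θ) * (10 * δ) := by
      apply mul_nonneg (mul_nonneg hpm0.le (by linarith)) (by linarith)
    nlinarith
  have h4θ : 0 ≤ p * m * (1 - 4 * θ) := mul_nonneg hpm0.le (by linarith)
  have hr : A' / m' ≤ A / m * (1 - p * m * (1 - 4 * θ)) := by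
    have e : A' / m' = A / m * (U * ((1 + 4 * δ) ^ 2 / (1 - δ))) := by
      rw [hA', hm']; field_simp
    rw [e]
    apply mul_le_mul_of_nonneg_left _ (by positivity)
    refine le_trans ?_ hUle
    apply mul_le_mul_of_nonneg_left _ hU0.le
    rw [div_le_iff₀ h1δ]
    nlinarith
  have hAm0 : 0 < A / m := by positivity
  have hry : p * A * (1 - 4 * θ) ≤ A / m - A' / m' := by
    have : A / m * (p * m * (1 - 4 * θ)) = p * A * (1 - 4 * θ) := by field_simp
    linarith
  have hpA4 : 0 ≤ p * A * (1 - 4 * θ) := mul_nonneg hpA0.le (by linarith)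
  have hm'ge : m * (1 - p * A * (1 + θ)) ≤ m' := by
    have e1 : 1 - 5 * δ ≤ (1 - δ) / (1 + 4 * δ) := by
      rw [le_div_iff₀ (by positivity)]; nlinarith
    have e2 : m' = m * (K * ((1 - δ) / (1 + 4 * δ))) := by rw [hm']; field_simp
    rw [e2]
    apply mul_le_mul_of_nonneg_left _ hm0.le
    have e3 : (1 - p * A) * (1 - 5 * δ) ≤ K * ((1 - δ) / (1 + 4 * δ)) := by
      apply mul_le_mul hK1 e1 (by linarith) hK0.le
    nlinarith
  refine ⟨hA'0, hm'0, ?_, ?_, by linarith, ?_, ?_⟩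
  · rw [hA']
    have e1 : U * (1 + 4 * δ) ≤ 1 := by
      have : U * (1 + 4 * δ) ≤ U * (1 + 10 * δ) := by gcongr; norm_num
      linarith
    have e2 : K * (U * (1 + 4 * δ)) ≤ 1 := by
      apply mul_le_one₀ hK2 (by positivity) e1
    calc K * U * A * (1 + 4 * δ) = K * (U * (1 + 4 * δ)) * A := by ring
      _ ≤ 1 * A := by gcongr
      _ = A := one_mul _
  · rw [hm']
    have : K / (1 + 4 * δ) ≤ 1 := by
      rw [div_le_one (by positivity)]; linarith
    apply mul_le_mul_of_nonneg_left _ h1δ.le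
    nlinarith
  · have : (1 - p * A) * (1 - p * m) ≤ K * U := by
      apply mul_le_mul hK1 hU1 (by linarith) hK0.le
    nlinarith
  · refine le_trans ?_ hm'ge
    apply mul_le_mul_of_nonneg_left _ hm0.le
    set w := (1 + 16 * θ) * (p * A * (1 - 4 * θ)) with hw
    have hw0 : 0 ≤ w := mul_nonneg (by linarith) hpA4
    have hβ : (1 + 16 * θ) * (1 - 4 * θ) ≤ 2 := by nlinarith
    have hw1 : w ≤ 2 * (p * A) := by
      have : w = ((1 + 16 * θ) * (1 - 4 * θ)) * (p * A) := by rw [hw]; ring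
      rw [this]; gcongr
    have hwθ : w ≤ 2 * θ := by linarith
    calc _ ≤ Real.exp (-w) := by
          rw [Real.exp_le_exp]
          have : w ≤ (1 + 16 * θ) * (A / m - A' / m') := by
            rw [hw]; gcongr
          linarith
      _ ≤ 1 - w + w ^ 2 := exp_neg_le hw0 (by linarith)
      _ ≤ _ := by
          have e1 : w * (1 - 2 * θ) ≤ w - w ^ 2 := by
            have := mul_le_mul_of_nonneg_left hwθ hw0
            linarith
          have e2 : (1 + θ) ≤ (1 + 16 * θ) * (1 - 4 * θ) * (1 - 2 * θ) := by
            have e4 : 0 ≤ θ * (9 - 88 * θ) := mul_nonneg hθ0.le (by linarith)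
            have e5 : 0 ≤ θ ^ 3 := by positivity
            linarith
          have e3 : p * A * (1 + θ) ≤ w * (1 - 2 * θ) := by
            have : w * (1 - 2 * θ) = p * A * ((1 + 16 * θ) * (1 - 4 * θ) * (1 - 2 * θ)) := by
              rw [hw]; ring
            rw [this]; gcongr
          linarith

end LC

namespace LC

lemma xbound {d : ℝ} (hd : 100 ≤ d) :
    4 * (9 * d ^ 2 * Real.exp (-(13 * Real.log d))) * (1 + (2 * d) ^ 2) ^ 4 ≤ 1 := by
  have hd0 : 0 < d := by linarith
  have he : Real.exp (-(13 * Real.log d)) = (d ^ 13)⁻¹ := by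
    rw [Real.exp_neg, mul_comm, Real.exp_mul, Real.exp_log hd0]
    norm_cast
  rw [he]
  have h1 : (1 + (2 * d) ^ 2) ^ 4 ≤ (5 * d ^ 2) ^ 4 := by
    apply pow_le_pow_left₀ (by positivity)
    nlinarith
  calc _ ≤ 4 * (9 * d ^ 2 * (d ^ 13)⁻¹) * (5 * d ^ 2) ^ 4 := by gcongr
    _ = 22500 / d ^ 3 := by field_simp; norm_num
    _ ≤ 1 := by
      rw [div_le_one (by positivity)]
      calc (22500 : ℝ) ≤ 100 ^ 3 := by norm_num
        _ ≤ d ^ 3 := by gcongr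

lemma expo {a b : ℝ} (h : b ≤ a) : Real.exp (-a) ≤ Real.exp (-b) := by
  rw [Real.exp_le_exp]; linarith

section Rec
variable {V C : Type} [Fintype V] [Fintype C] {G : SimpleGraph V} {L : V → Finset C}

lemma finish_num [Nonempty C] {d A m ℓ : ℝ} (hd : 100 ≤ d) (hℓ : ℓ = Real.log d) (hℓ1 : 1 ≤ ℓ)
    (hA : 0 < A) (hAd : A ≤ 2 * d) (hI : Inv G L A m) (hD : ∀ v, ((L v).card : ℝ) ≤ 2 * d)
    (hm : 10 ^ 10 * ℓ ≤ m) (hAm : 1000 * ℓ * A ≤ m) : Col G L := by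
  apply finish (x := 9 * d ^ 2 * Real.exp (-(13 * Real.log d))) hA (by linarith) hI hD hAd _ (xbound hd)
  have h1 := expo (a := (m - 1) / 16) (b := 13 * Real.log d) (by rw [← hℓ]; linarith)
  have h2 := expo (a := (m - 1) / (8 * (A + 1))) (b := 13 * Real.log d) (by
    rw [← hℓ, le_div_iff₀ (by positivity)]
    nlinarith)
  have h3 : 2 * Real.exp (-(13 * Real.log d)) ≤ 9 * d ^ 2 * Real.exp (-(13 * Real.log d)) := by
    apply mul_le_mul_of_nonneg_right _ (Real.exp_pos _).le
    nlinarith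
  linarith

set_option maxHeartbeats 1000000 in
lemma step_num {θ d k A m s δ ℓ : ℝ} (hθ0 : 0 < θ) (hθ1 : θ ≤ 1 / 32)
    (hd : 100 ≤ d) (hℓ : ℓ = Real.log d) (hℓ1 : 1 ≤ ℓ) (hk : 1 ≤ k)
    (hδ : δ * ℓ * 10 ^ 4 = θ ^ 2) (hs : 10 ^ 10 * ℓ ≤ s * δ ^ 3)
    (hA : 0 < A) (hAd : A ≤ 2 * d) (hAl : A ≤ ℓ * m) (hmA : m ≤ 1000 * ℓ * A)
    (hms : Real.sqrt k * s ≤ m)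
    (hI : Inv G L A m) (hS : Sparse G L k) (hD : ∀ v, ((L v).card : ℝ) ≤ 2 * d) :
    ∃ (L' : V → Finset C) (A' m' : ℝ), (∀ v, L' v ⊆ L v) ∧ Inv G L' A' m' ∧ (Col G L' → Col G L) ∧
      0 < A' ∧ 0 < m' ∧ A' ≤ A ∧ m' ≤ (1 - δ) * m ∧ A' / m' ≤ A / m ∧
      m * Real.exp (-((1 + 16 * θ) * (A / m - A' / m'))) ≤ m' := by
  have hδ0 : 0 < δ := by
    have : 0 < δ * (ℓ * 10 ^ 4) := by rw [← mul_assoc, hδ]; positivity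
    exact pos_of_mul_pos_left this (by positivity)
  have hδℓ : δ * ℓ ≤ 1 / 1000 := by nlinarith
  have hδ1 : δ ≤ 1 / 1000 := by nlinarith
  have hs0 : 0 < s := by
    have : 0 < s * δ ^ 3 := by linarith
    exact pos_of_mul_pos_left this (by positivity)
  have hsk : 1 ≤ Real.sqrt k := by rw [Real.one_le_sqrt]; exact hk
  have hδ31 : δ ^ 3 ≤ δ ^ 2 := pow_le_pow_of_le_one hδ0.le (by linarith) (by norm_num)
  have hδ21 : δ ^ 2 ≤ δ := by nlinarith
  have hsm : s ≤ m := by nlinarith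
  have hm0 : 0 < m := by linarith
  have hmδ2 : 10 ^ 10 * ℓ ≤ m * δ ^ 2 := by
    calc _ ≤ s * δ ^ 3 := hs
      _ ≤ m * δ ^ 2 := by gcongr
  have hmδ : 10 ^ 10 * ℓ ≤ m * δ := hmδ2.trans (by gcongr)
  have hm1 : 10 ^ 10 ≤ m := by nlinarith
  -- A bound
  have hAδ : 10 ^ 7 * Real.sqrt k * ℓ ≤ A * δ ^ 2 := by
    have e1 : Real.sqrt k * (10 ^ 10 * ℓ) ≤ Real.sqrt k * (s * δ ^ 3) := by gcongr
    have e2 : Real.sqrt k * s * δ ^ 3 ≤ 1000 * ℓ * A * δ ^ 3 := by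
      apply mul_le_mul_of_nonneg_right (hms.trans hmA) (by positivity)
    have e3 : 1000 * ℓ * A * δ ^ 3 ≤ 1000 * (A * δ ^ 2) := by
      have : (δ * ℓ) * (1000 * (A * δ ^ 2)) ≤ 1 * (1000 * (A * δ ^ 2)) := by
        apply mul_le_mul_of_nonneg_right (by linarith) (by positivity)
      linarith
    linarith
  have hAδ1 : 10 ^ 7 * ℓ ≤ A * δ ^ 2 := by
    refine le_trans ?_ hAδ
    have : 10 ^ 7 * ℓ * 1 ≤ 10 ^ 7 * ℓ * Real.sqrt k := by gcongr
    linarith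
  have hAsq : k * 10 ^ 14 * ℓ ≤ A ^ 2 * δ ^ 4 := by
    have e1 : (10 ^ 7 * Real.sqrt k * ℓ) ^ 2 ≤ (A * δ ^ 2) ^ 2 := by gcongr
    have e2 : (10 ^ 7 * Real.sqrt k * ℓ) ^ 2 = k * 10 ^ 14 * ℓ ^ 2 := by
      rw [mul_pow, mul_pow, Real.sq_sqrt (by linarith)]; ring
    have e3 : k * 10 ^ 14 * ℓ ≤ k * 10 ^ 14 * ℓ ^ 2 := by
      gcongr; nlinarith
    calc _ ≤ _ := e3
      _ = _ := e2.symm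
      _ ≤ _ := e1
      _ = _ := by ring
  have hAsq3 : k * 10 ^ 14 * ℓ ≤ A ^ 2 * δ ^ 3 :=
    hAsq.trans (by
      apply mul_le_mul_of_nonneg_left _ (by positivity)
      exact pow_le_pow_of_le_one hδ0.le (by linarith) (by norm_num))
  have hAsq1 : k * 10 ^ 14 * ℓ ≤ A ^ 2 * δ :=
    hAsq3.trans (by
      apply mul_le_mul_of_nonneg_left _ (by positivity)
      linarith)
  set p : ℝ := θ / (A + m) with hp
  have hpAm : p * (A + m) = θ := by rw [hp]; field_simp
  have hp0 : 0 < p := by rw [hp]; positivity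
  have h1 : 10 * δ ≤ p * m * θ := by
    have : θ ≤ p * m * (2 * ℓ) := by
      rw [← hpAm]
      have e0 : m * 1 ≤ m * ℓ := by gcongr
      have : A + m ≤ m * (2 * ℓ) := by linarith
      have := mul_le_mul_of_nonneg_left this hp0.le
      linarith
    have e : θ * θ ≤ p * m * (2 * ℓ) * θ := by gcongr
    have e2 : ℓ * (10 * δ) ≤ ℓ * (p * m * θ) := by
      have : 0 < δ * ℓ := by positivity
      linarith
    exact le_of_mul_le_mul_left e2 (by linarith)
  have h2 : 5 * δ ≤ p * A * θ := by
    have : θ ≤ p * A * (1001 * ℓ) := by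
      rw [← hpAm]
      have e0 : A * 1 ≤ A * ℓ := by gcongr
      have : A + m ≤ A * (1001 * ℓ) := by linarith
      have := mul_le_mul_of_nonneg_left this hp0.le
      linarith
    have e : θ * θ ≤ p * A * (1001 * ℓ) * θ := by gcongr
    have e2 : ℓ * (5 * δ) ≤ ℓ * (p * A * θ) := by
      have : 0 < δ * ℓ := by positivity
      linarith
    exact le_of_mul_le_mul_left e2 (by linarith)
  set n := ⌊A⌋₊ with hn
  set K := (1 - p) ^ n with hK
  set z := ⌈(1 - δ) * (K * (m - 1))⌉₊ with hz
  set U := (1 - p) ^ z with hU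
  obtain ⟨_, hsum, hpθ, hK1, hK2, hU1, hU2⟩ := num1 hθ0 hθ1 hA (by linarith) hp hδ0 h1
    (by linarith) hn hK hz hU
  obtain ⟨g1, g2, g3, g4, g5, g6, g7⟩ := num2 hθ0 hθ1 hA (by linarith) hp0 hsum hK1 hK2 hU1 hU2 hδ0
    h1 h2 rfl rfl
  have hpA0 : 0 < p * A := by positivity
  have hpm0 : 0 < p * m := by positivity
  have hKh : 1 / 2 ≤ K := by linarith
  set b := ⌈6 * k / (δ * A)⌉₊ with hb
  have hb0 : 0 < b := Nat.ceil_pos.mpr (by positivity)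
  have hbR : (0:ℝ) < b := by exact_mod_cast hb0
  have hb1 : 6 * k / (δ * A) ≤ b := Nat.le_ceil _
  have hb2 : (b : ℝ) < 6 * k / (δ * A) + 1 := Nat.ceil_lt_add_one (by positivity)
  have hbM : 234 * ℓ * b ≤ δ ^ 2 * A := by
    have e1 : 234 * ℓ * (6 * k / (δ * A)) ≤ δ ^ 2 * A / 2 := by
      rw [mul_div_assoc', div_le_iff₀ (by positivity)]
      have : k * ℓ ≤ k * 10 ^ 14 * ℓ := by
        have : 0 < k * ℓ := by positivity
        linarith
      have : 0 < k * ℓ := by positivity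
      linarith
    have e2 : 234 * ℓ * b ≤ 234 * ℓ * (6 * k / (δ * A) + 1) := by gcongr
    linarith
  have hbA : (b : ℝ) ≤ A := by
    have e1 : (b : ℝ) ≤ 234 * ℓ * b := by
      have : 1 * (b : ℝ) ≤ 234 * ℓ * b := by
        apply mul_le_mul_of_nonneg_right (by linarith) hbR.le
      linarith
    have e2 : δ ^ 2 * A ≤ 1 * A := by gcongr; linarith
    linarith
  have hpk : 4 * p * k ≤ δ * A := by
    have e1 : A * (4 * p * k) ≤ A * (δ * A) := by
      have : p * A ≤ 1 := by linarith
      have : p * A * k ≤ 1 * k := by gcongr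
      have : k ≤ k * 10 ^ 14 * ℓ := by
        have : k * 1 ≤ k * (10 ^ 14 * ℓ) := by
          apply mul_le_mul_of_nonneg_left (by linarith) (by linarith)
        linarith
      have : k * 4 ≤ k * (10 ^ 14 * ℓ) := by
        apply mul_le_mul_of_nonneg_left (by linarith) (by linarith)
      linarith
    exact le_of_mul_le_mul_left e1 hA
  obtain ⟨L', i1, i2, i3⟩ := step (G := G) (L := L) (p := p) (A := A) (m := m) (k := k) (δ := δ) (l := δ / 6)
    (σ := δ * A / (3 * b)) (D := 2 * d) (x := 9 * d ^ 2 * Real.exp (-(13 * Real.log d)))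
    n b z hp0.le (by linarith) (by linarith) hA hn hδ0.le (by linarith) hm0 hz g6 rfl hpk hb0
    (by positivity) (by linarith)
    (by
      have e1 : 2 * k / b ≤ δ * A / 3 := by
        rw [div_le_iff₀ (by positivity)] at hb1 ⊢
        linarith
      have e2 : b * (δ * A / (3 * b)) = δ * A / 3 := by field_simp
      rw [e2]
      linarith)
    hI hS hD hAd
    (by
      have f1 := expo (a := δ ^ 2 * (K * (m - 1)) / 2) (b := 13 * Real.log d) (by
        rw [← hℓ]
        have : (1 / 2) * (m / 2) ≤ K * (m - 1) := by
          apply mul_le_mul hKh (by linarith) (by linarith) (by linarith)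
        have : δ ^ 2 * ((1 / 2) * (m / 2)) ≤ δ ^ 2 * (K * (m - 1)) := by gcongr
        linarith)
      have f2 := expo (a := δ / 6 * (δ * A / (3 * b))) (b := 13 * Real.log d) (by
        rw [← hℓ]
        have : δ / 6 * (δ * A / (3 * b)) = δ ^ 2 * A / (18 * b) := by field_simp; ring
        rw [this, le_div_iff₀ (by positivity)]
        linarith)
      have f3 := expo (a := δ ^ 2 * (K / (1 + 4 * δ) * m) / 2) (b := 13 * Real.log d) (by
        rw [← hℓ]
        have : 1 / 4 ≤ K / (1 + 4 * δ) := by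
          rw [le_div_iff₀ (by positivity)]; linarith
        have : 1 / 4 * m ≤ K / (1 + 4 * δ) * m := by gcongr
        have : δ ^ 2 * (1 / 4 * m) ≤ δ ^ 2 * (K / (1 + 4 * δ) * m) := by gcongr
        linarith)
      set e := Real.exp (-(13 * Real.log d)) with he
      have he0 : 0 < e := Real.exp_pos _
      calc _ ≤ 2 * d * (2 * d * e + 2 * d * e) + e := by
            have hbd : (b : ℝ) ≤ 2 * d := hbA.trans hAd
            gcongr
        _ ≤ 9 * d ^ 2 * e := by
            have : e * 1 ≤ e * d ^ 2 := by gcongr; nlinarith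
            linarith)
    (xbound hd)
  exact ⟨L', _, _, i1, i2, i3, g1, g2, g3, g4, g5, g7⟩

lemma main_rec [Nonempty C] {θ d k s δ ℓ : ℝ} (hθ0 : 0 < θ) (hθ1 : θ ≤ 1 / 32)
    (hd : 100 ≤ d) (hℓ : ℓ = Real.log d) (hℓ1 : 1 ≤ ℓ) (hk : 1 ≤ k)
    (hδ : δ * ℓ * 10 ^ 4 = θ ^ 2) (hδ0 : 0 < δ) (hδ1 : δ ≤ 1) (hs : 10 ^ 10 * ℓ ≤ s * δ ^ 3) (n : ℕ) :
    ∀ (L : V → Finset C) (A m : ℝ), 0 < A → A ≤ 2 * d → 0 < m → A / m ≤ ℓ →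
    Real.sqrt k * s * Real.exp ((1 + 16 * θ) * (A / m)) ≤ m → (1 - δ) ^ n * m ≤ Real.sqrt k * s →
    Inv G L A m → Sparse G L k → (∀ v, ((L v).card : ℝ) ≤ 2 * d) → Col G L := by
  have hs0 : 0 < s := by
    have : 0 < s * δ ^ 3 := by linarith
    exact pos_of_mul_pos_left this (by positivity)
  have hsk : 1 ≤ Real.sqrt k := by rw [Real.one_le_sqrt]; exact hk
  induction n with
  | zero =>
    intro L A m hA _ hm _ h1 h2
    exfalso
    rw [pow_zero, one_mul] at h2
    have : 1 < Real.exp ((1 + 16 * θ) * (A / m)) := by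
      rw [Real.one_lt_exp_iff]; positivity
    have : 0 < Real.sqrt k * s := by positivity
    nlinarith
  | succ n ih =>
    intro L A m hA hAd hm hr h1 h2 hI hS hD
    have hms : Real.sqrt k * s ≤ m := by
      have : 1 ≤ Real.exp ((1 + 16 * θ) * (A / m)) := by
        rw [Real.one_le_exp_iff]; positivity
      have : 0 < Real.sqrt k * s := by positivity
      nlinarith
    by_cases hcase : 1000 * ℓ * A ≤ m
    · apply finish_num hd hℓ hℓ1 hA hAd hI hD _ hcase
      have e1 : s * δ ^ 3 ≤ s * 1 := by gcongr; exact pow_le_one₀ hδ0.le hδ1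
      nlinarith
    · push Not at hcase
      obtain ⟨L', A', m', g1, g2, g3, g4, g5, g6, g7, g8, g9⟩ := step_num hθ0 hθ1 hd hℓ hℓ1 hk hδ hs hA hAd
        (by rw [div_le_iff₀ hm] at hr; exact hr) hcase.le hms hI hS hD
      apply g3
      apply ih L' A' m' g4 (g6.trans hAd) g5 (g8.trans hr) _ _ g2 (hS.mono g1)
      · intro v
        refine le_trans ?_ (hD v)
        exact_mod_cast Finset.card_le_card (g1 v)
      · refine le_trans ?_ g9
        calc _ = Real.sqrt k * s * Real.exp ((1 + 16 * θ) * (A / m)) *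
              Real.exp (-((1 + 16 * θ) * (A / m - A' / m'))) := by
              rw [mul_assoc (Real.sqrt k * s), ← Real.exp_add]
              congr 2
              ring
          _ ≤ _ := by gcongr
      · calc (1 - δ) ^ n * m' ≤ (1 - δ) ^ n * ((1 - δ) * m) := by
              apply mul_le_mul_of_nonneg_left g7
              apply pow_nonneg; linarith
          _ = (1 - δ) ^ (n + 1) * m := by ring
          _ ≤ _ := h2

end Rec
end LC

namespace LC

lemma transport {V : Type} [Fintype V] (G : SimpleGraph V) (L : V → Finset ℕ) {d k m₀ : ℝ} {q : ℕ}
    (hd : 0 < d) (hqd : (q : ℝ) ≤ 2 * d) (hq : 2 * m₀ ≤ q)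
    (h1 : ∀ v : V, ∀ c ∈ L v, ((NL G L v c).card : ℝ) ≤ d)
    (h2 : ∀ v : V, ∀ c ∈ L v, (pairsWithin G (NL G L v c) : ℝ) ≤ 2 * k)
    (h3 : ∀ v, q ≤ (L v).card) (hq0 : 0 < q)
    (H : ∀ (C : Type) [Fintype C] [Nonempty C] (L' : V → Finset C), Inv G L' (2 * d) m₀ → Sparse G L' k →
      (∀ v, ((L' v).card : ℝ) ≤ 2 * d) → Col G L') :
    ∃ φ : V → ℕ, (∀ v : V, φ v ∈ L v) ∧ ∀ u v : V, G.Adj u v → φ u ≠ φ v := by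
  choose T hT hTc using fun v => Finset.exists_subset_card_eq (h3 v)
  set B := univ.sup fun v => (L v).sup id with hB
  have hBle : ∀ v, ∀ c ∈ L v, c < B + 1 := by
    intro v c hc
    have e1 : c ≤ (L v).sup id := Finset.le_sup (f := id) hc
    have e2 : (L v).sup id ≤ B := Finset.le_sup (f := fun v => (L v).sup id) (Finset.mem_univ v)
    omega
  set L' : V → Finset (Fin (B + 1)) := fun v => univ.filter fun i => (i : ℕ) ∈ T v with hL'
  have hmem : ∀ v (c : Fin (B + 1)), c ∈ L' v ↔ (c : ℕ) ∈ T v := by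
    intro v c; simp [hL']
  have hcard : ∀ v, (L' v).card = q := by
    intro v
    rw [← hTc v]
    apply Finset.card_bij (fun (c : Fin (B + 1)) _ => (c : ℕ))
    · intro c hc; exact (hmem v c).mp hc
    · intro a _ b _ h; exact Fin.ext h
    · intro c hc
      exact ⟨⟨c, hBle v c (hT v hc)⟩, (hmem v _).mpr hc, rfl⟩
  have hN : ∀ v (c : Fin (B + 1)), N G L' v c ⊆ NL G L v c := by
    intro v c u hu
    rw [mem_N, hmem] at hu
    unfold NL
    rw [Finset.mem_filter, SimpleGraph.mem_neighborFinset]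
    exact ⟨hu.1, hT u hu.2⟩
  have hNd : ∀ v, ∀ c ∈ L' v, ((N G L' v c).card : ℝ) ≤ d := by
    intro v c hc
    refine le_trans ?_ (h1 v c (hT v ((hmem v c).mp hc)))
    exact_mod_cast Finset.card_le_card (hN v c)
  have hne : ∀ v, (L' v).Nonempty := by
    intro v
    rw [← Finset.card_pos, hcard]
    exact hq0
  obtain ⟨φ, hφ⟩ := H (Fin (B + 1)) L' ⟨fun v c hc => (hNd v c hc).trans (by linarith), by
      intro v _
      calc m₀ ≤ (q : ℝ) * (1 / 2) := by linarith
        _ = ∑ c ∈ L' v, (1 / 2 : ℝ) := by rw [Finset.sum_const, nsmul_eq_mul, hcard]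
        _ ≤ _ := by
          apply Finset.sum_le_sum
          intro c hc
          have : ((N G L' v c).card : ℝ) / (2 * d) ≤ 1 / 2 := by
            rw [div_le_iff₀ (by positivity)]
            linarith [hNd v c hc]
          linarith⟩ (by
      intro v c hc
      refine le_trans ?_ (h2 v c (hT v ((hmem v c).mp hc)))
      unfold pairsWithin
      exact_mod_cast Finset.card_le_card (Finset.filter_subset_filter _
        (Finset.product_subset_product (hN v c) (hN v c)))) (by
      intro v
      rw [hcard]
      exact hqd)
  refine ⟨fun v => (φ v : ℕ), fun v => hT v ((hmem v _).mp (hφ v (hne v)).1), ?_⟩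
  intro u v huv he
  exact (hφ v (hne v)).2 u huv.symm (hne u) (Fin.ext he)

end LC


set_option maxHeartbeats 1000000 in

/-- Proposition: list coloring with constraints on color-degrees and local sparsity of the
lists. -/
theorem stmt0 (γ : ℝ) (hγ : γ ∈ Set.Ioo (0 : ℝ) 1) :
    ∃ d₀ : ℝ, ∀ d : ℝ, d₀ ≤ d → ∀ k : ℝ, 1 ≤ k → k ≤ d ^ (2 * γ) →
      ∀ (V : Type) [Fintype V] (G : SimpleGraph V) (L : V → Finset ℕ),
        (∀ v : V, ∀ c ∈ L v, ((NL G L v c).card : ℝ) ≤ d) →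
        (∀ v : V, ∀ c ∈ L v, (pairsWithin G (NL G L v c) : ℝ) ≤ 2 * k) →
        (∀ v : V, 4 * (1 + γ) * d / Real.log (d / Real.sqrt k) ≤ ((L v).card : ℝ)) →
        ∃ φ : V → ℕ, (∀ v : V, φ v ∈ L v) ∧ ∀ u v : V, G.Adj u v → φ u ≠ φ v := by

  obtain ⟨hγ0, hγ1⟩ := hγ
  set θ : ℝ := γ / 32 with hθ
  have hθ0 : 0 < θ := by positivity
  have hθ1 : θ ≤ 1 / 32 := by rw [hθ]; linarith
  set e1 : ℝ := (γ / 2) / (1 + γ) with he1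
  have he10 : 0 < e1 := by positivity
  set ε : ℝ := (1 - γ) * e1 / 2 with hε
  have h1γ : 0 < 1 - γ := by linarith
  have hε0 : 0 < ε := by positivity
  set ℓ₀ : ℝ := 120 * 10 ^ 22 / (θ ^ 6 * ε ^ 5) + 8 / (1 - γ) + 100 with hℓ₀
  have ha : 0 < 120 * 10 ^ 22 / (θ ^ 6 * ε ^ 5) := by positivity
  have hb : 0 < 8 / (1 - γ) := by positivity
  refine ⟨Real.exp ℓ₀, ?_⟩
  intro d hd k hk hkd V _ G L h1 h2 h3
  have hd0 : 0 < d := lt_of_lt_of_le (Real.exp_pos _) hd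
  have hd100 : 100 ≤ d := by linarith [Real.add_one_le_exp ℓ₀]
  set ℓ := Real.log d with hℓ
  have hℓ0 : ℓ₀ ≤ ℓ := by
    rw [hℓ, Real.le_log_iff_exp_le hd0]; exact hd
  have hℓ1 : 1 ≤ ℓ := by linarith
  have hℓpos : 0 < ℓ := by linarith
  have hk0 : 0 < k := by linarith
  have hsk0 : 0 < Real.sqrt k := Real.sqrt_pos.mpr hk0
  set lM := Real.log (d / Real.sqrt k) with hlM
  have hlMeq : lM = ℓ - Real.log k / 2 := by
    rw [hlM, Real.log_div hd0.ne' hsk0.ne', Real.log_sqrt hk0.le]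
  have hlogk : Real.log k ≤ 2 * γ * ℓ := by
    have := Real.log_le_log hk0 hkd
    rwa [Real.log_rpow hd0] at this
  have hlMge : (1 - γ) * ℓ ≤ lM := by rw [hlMeq]; linarith
  have hlMle : lM ≤ ℓ := by
    rw [hlMeq]; linarith [Real.log_nonneg hk]
  have hlM8 : 8 ≤ lM := by
    refine le_trans ?_ hlMge
    have : 8 / (1 - γ) ≤ ℓ := by linarith
    rw [div_le_iff₀ h1γ] at this
    linarith
  have hlM0 : 0 < lM := by linarith
  have hMexp : d = Real.sqrt k * Real.exp lM := by
    rw [hlM, Real.exp_log (by positivity)]; field_simp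
  set s := Real.exp (ε * ℓ) with hs
  set δ : ℝ := θ ^ 2 / (10 ^ 4 * ℓ) with hδ
  have hδ0 : 0 < δ := by positivity
  have hδeq : δ * ℓ * 10 ^ 4 = θ ^ 2 := by rw [hδ]; field_simp
  have hδ1 : δ ≤ 1 / 2 := by
    rw [hδ, div_le_iff₀ (by positivity)]
    nlinarith
  have hs1 : 10 ^ 22 * ℓ ^ 4 ≤ s * θ ^ 6 := by
    have := Real.pow_div_factorial_le_exp (ε * ℓ) (by positivity) 5
    have e2 : (Nat.factorial 5 : ℝ) = 120 := by norm_num [Nat.factorial]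
    rw [e2] at this
    have e3 : 120 * 10 ^ 22 ≤ ℓ * (θ ^ 6 * ε ^ 5) := by
      have : 120 * 10 ^ 22 / (θ ^ 6 * ε ^ 5) ≤ ℓ := by linarith
      rwa [div_le_iff₀ (by positivity)] at this
    have e4 : 120 * 10 ^ 22 * ℓ ^ 4 ≤ ℓ * (θ ^ 6 * ε ^ 5) * ℓ ^ 4 := by gcongr
    have e5 : (ε * ℓ) ^ 5 / 120 * θ ^ 6 ≤ s * θ ^ 6 := by gcongr
    refine le_trans ?_ e5
    have e6 : (ε * ℓ) ^ 5 / 120 * θ ^ 6 = ℓ * (θ ^ 6 * ε ^ 5) * ℓ ^ 4 / 120 := by ring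
    rw [e6]
    linarith
  have hs2 : 10 ^ 10 * ℓ ≤ s * δ ^ 3 := by
    have : s * δ ^ 3 = s * θ ^ 6 / (10 ^ 12 * ℓ ^ 3) := by rw [hδ]; field_simp
    rw [this, le_div_iff₀ (by positivity)]
    refine le_trans (le_of_eq ?_) hs1
    ring
  have hℓs : ℓ ≤ s := by
    have : θ ^ 6 ≤ 1 := pow_le_one₀ hθ0.le (by linarith)
    have e2 : s * θ ^ 6 ≤ s * 1 := by
      apply mul_le_mul_of_nonneg_left this (Real.exp_pos _).le
    have e3 : ℓ ≤ ℓ ^ 4 := le_self_pow₀ hℓ1 (by norm_num)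
    linarith
  set m₀ : ℝ := 2 * (1 + γ) * d / lM with hm₀
  have hm₀0 : 0 < m₀ := by positivity
  have hm₀2 : 2 * m₀ = 4 * (1 + γ) * d / lM := by rw [hm₀]; ring
  have hqle : 4 * (1 + γ) * d / lM ≤ d := by
    rw [div_le_iff₀ hlM0]
    have e2 : d * 8 ≤ d * lM := mul_le_mul_of_nonneg_left hlM8 hd0.le
    have e3 : γ * d ≤ 1 * d := mul_le_mul_of_nonneg_right hγ1.le hd0.le
    linarith
  have hr₀ : 2 * d / m₀ = lM / (1 + γ) := by
    rw [hm₀]; field_simp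
  have hpot : Real.sqrt k * s * Real.exp ((1 + 16 * θ) * (2 * d / m₀)) ≤ m₀ := by
    rw [hr₀]
    have e2 : (1 + 16 * θ) * (lM / (1 + γ)) = lM - e1 * lM := by
      rw [hθ, he1]; field_simp; ring
    rw [e2, sub_eq_add_neg, Real.exp_add]
    have e3 : Real.exp (-(e1 * lM)) ≤ Real.exp (-(2 * (ε * ℓ))) := by
      apply LC.expo
      have : e1 * ((1 - γ) * ℓ) ≤ e1 * lM := by gcongr
      rw [hε]
      linarith
    have e4 : Real.exp (-(2 * (ε * ℓ))) = (s * s)⁻¹ := by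
      rw [hs, ← Real.exp_add, ← Real.exp_neg]; congr 1; ring
    have hspos : 0 < s := Real.exp_pos _
    calc Real.sqrt k * s * (Real.exp lM * Real.exp (-(e1 * lM)))
        = (Real.sqrt k * Real.exp lM) * (s * Real.exp (-(e1 * lM))) := by ring
      _ = d * (s * Real.exp (-(e1 * lM))) := by rw [← hMexp]
      _ ≤ d * (s * (s * s)⁻¹) := by rw [← e4]; gcongr
      _ = d / s := by field_simp
      _ ≤ d / lM := div_le_div_of_nonneg_left hd0.le hlM0 (by linarith)
      _ ≤ m₀ := by
        rw [hm₀]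
        apply div_le_div_of_nonneg_right _ hlM0.le
        have e5 := mul_pos hγ0 hd0
        linarith
  obtain ⟨n, hn⟩ := exists_pow_lt_of_lt_one (show 0 < Real.sqrt k * s / m₀ by positivity)
    (show 1 - δ < 1 by linarith)
  set q := ⌈4 * (1 + γ) * d / lM⌉₊ with hq
  refine LC.transport G L (d := d) (k := k) (m₀ := m₀) (q := q) hd0 ?_ ?_ h1 h2 ?_ ?_ ?_
  · have := Nat.ceil_lt_add_one (show 0 ≤ 4 * (1 + γ) * d / lM by positivity)
    rw [← hq] at this
    linarith
  · rw [hm₀2]; exact Nat.le_ceil _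
  · intro v
    exact Nat.ceil_le.mpr (h3 v)
  · exact Nat.ceil_pos.mpr (by positivity)
  · intro C _ _ L' hI hS hD
    apply LC.main_rec hθ0 hθ1 hd100 hℓ hℓ1 hk hδeq hδ0 (by linarith) hs2 n L' (2 * d) m₀ (by linarith)
      le_rfl hm₀0 _ hpot _ hI hS hD
    · rw [hr₀, div_le_iff₀ (by linarith)]
      have e5 := mul_pos hℓpos hγ0
      linarith
    · rw [lt_div_iff₀ hm₀0] at hn
      exact hn.le
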